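/- arXiv:1512.01369 — 2 statements merged into one kernel-verified Lean document; each statement's English description precedes it below -/
import Mathlib

section
/- Let Γ be a group generated by a finite symmetric set S containing the identity, and suppose that for some constants C, D > 0 one has |Sⁿ| ≤ C·n^D for all n ≥ 1. Then Γ is virtually nilpotent. -/
open Pointwise

/-- A group is virtually nilpotent if it has a nilpotent subgroup of finite index. -/
def IsVirtuallyNilpotent (G : Type*) [Group G] : Prop :=
  ∃ H : Subgroup G, H.FiniteIndex ∧ Group.IsNilpotent H

/-- The expectation of `F` after `n` steps of the random walk whose steps are uniform on `S`. -/
noncomputable def walk {G E : Type*} [Group G] [AddCommGroup E] [Module ℝ E] (S : Finset G) :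
    ℕ → (G → E) → E
  | 0, F => F 1
  | n + 1, F => (S.card : ℝ)⁻¹ • ∑ s ∈ S, walk S n fun x => F (s * x)

/-- The distribution after `n` steps of the random walk whose steps are uniform on `S`. -/
noncomputable def walkMass {G : Type*} [Group G] (S : Finset G) : ℕ → G → ℝ
  | 0, x => Set.indicator {1} 1 x
  | n + 1, x => (S.card : ℝ)⁻¹ * ∑ s ∈ S, walkMass S n (s⁻¹ * x)

/-- The Shannon entropy of the random walk after `n` steps. -/
noncomputable def walkEntropy {G : Type*} [Group G] [DecidableEq G] (S : Finset G) (n : ℕ) : ℝ :=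
  ∑ x ∈ S ^ n, Real.negMulLog (walkMass S n x)

section Walk

variable {G : Type*} [Group G] [DecidableEq G] {S : Finset G}

omit [DecidableEq G] in
lemma walkMass_nonneg (n : ℕ) (x : G) : 0 ≤ walkMass S n x := by
  induction n generalizing x with
  | zero => exact Set.indicator_nonneg (by simp) x
  | succ n ih => exact mul_nonneg (by positivity) (Finset.sum_nonneg fun s _ => ih _)

lemma walkMass_eq_zero {n : ℕ} {x : G} (hx : x ∉ S ^ n) : walkMass S n x = 0 := by
  induction n generalizing x with
  | zero => exact Set.indicator_of_notMem (by simpa using hx) _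
  | succ n ih =>
    rw [walkMass, Finset.sum_eq_zero, mul_zero]
    intro s hs
    refine ih fun h => hx ?_
    rw [pow_succ', show x = s * (s⁻¹ * x) by group]
    exact Finset.mul_mem_mul hs h

lemma inv_smul_pow_subset {n : ℕ} {s : G} (hs : s ∈ S) {T : Finset G} (hT : S ^ (n + 1) ⊆ T) :
    S ^ n ⊆ s⁻¹ • T := by
  intro x hx
  rw [Finset.mem_inv_smul_finset_iff]
  exact hT (by rw [pow_succ', smul_eq_mul]; exact Finset.mul_mem_mul hs hx)

lemma sum_walkMass_shift (ψ : ℝ → ℝ) (hψ : ψ 0 = 0) (n : ℕ) {s : G} (hs : s ∈ S) :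
    ∑ x ∈ S ^ (n + 1), ψ (walkMass S n (s⁻¹ * x)) = ∑ x ∈ S ^ n, ψ (walkMass S n x) := by
  refine Eq.trans ?_ (Finset.sum_subset (inv_smul_pow_subset hs subset_rfl)
    fun x _ hx => by rw [walkMass_eq_zero hx, hψ]).symm
  refine Finset.sum_bij (fun x _ => s⁻¹ * x) ?_ ?_ ?_ ?_
  · intro x hx; simpa [Finset.mem_inv_smul_finset_iff] using hx
  · simp
  · intro y hy
    exact ⟨s * y, by simpa [Finset.mem_inv_smul_finset_iff] using hy, by group⟩
  · simp

lemma walk_eq_sum {E : Type*} [AddCommGroup E] [Module ℝ E] (n : ℕ) (F : G → E) {T : Finset G}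
    (hT : S ^ n ⊆ T) : walk S n F = ∑ x ∈ T, walkMass S n x • F x := by
  induction n generalizing F T with
  | zero =>
    have h1 : (1 : G) ∈ T := hT (by simp)
    rw [Finset.sum_eq_single_of_mem 1 h1]
    · simp [walk, walkMass]
    · intro x _ hx; simp [walkMass, hx]
  | succ n ih =>
    simp only [walk, walkMass, mul_smul, Finset.sum_smul]
    rw [← Finset.smul_sum, Finset.sum_comm]
    congr 1
    refine Finset.sum_congr rfl fun s hs => ?_
    rw [ih _ (inv_smul_pow_subset hs hT)]
    refine Finset.sum_bij (fun x _ => s * x) ?_ ?_ ?_ ?_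
    · intro x hx; simpa [Finset.mem_inv_smul_finset_iff] using hx
    · simp
    · intro y hy
      exact ⟨s⁻¹ * y, by simpa [Finset.mem_inv_smul_finset_iff] using hy, by group⟩
    · simp

omit [DecidableEq G] in
lemma walk_const {E : Type*} [AddCommGroup E] [Module ℝ E] (hS : S.Nonempty) (n : ℕ) (c : E) :
    walk S n (fun _ => c) = c := by
  have : (S.card : ℝ) ≠ 0 := by simpa using hS.ne_empty
  induction n with
  | zero => rfl
  | succ n ih => simp [walk, ih, ← Nat.cast_smul_eq_nsmul ℝ, smul_smul, this]

lemma sum_walkMass (hS : S.Nonempty) (n : ℕ) : ∑ x ∈ S ^ n, walkMass S n x = 1 := by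
  have := walk_eq_sum (S := S) n (fun _ => (1 : ℝ)) subset_rfl
  simpa [walk_const hS] using this.symm

lemma walk_nonneg {F : G → ℝ} (hF : ∀ x, 0 ≤ F x) (n : ℕ) : 0 ≤ walk S n F := by
  rw [walk_eq_sum n F subset_rfl]
  exact Finset.sum_nonneg fun x _ => mul_nonneg (walkMass_nonneg n x) (hF x)

lemma sq_sqrt_sub_sqrt_le {a q : ℝ} (ha : 0 ≤ a) (hq : 0 ≤ q) (h : q = 0 → a = 0) :
    (√a - √q) ^ 2 ≤ a * Real.log a - a * Real.log q - a + q := by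
  rcases hq.eq_or_lt with hq' | hq'
  · simp [h hq'.symm, ← hq']
  rcases ha.eq_or_lt with ha' | ha'
  · simp [← ha', Real.sq_sqrt hq]
  have hsa : 0 < √a := Real.sqrt_pos.2 ha'
  have hsq : 0 < √q := Real.sqrt_pos.2 hq'
  have h1 := Real.log_le_sub_one_of_pos (div_pos hsq hsa)
  rw [Real.log_div hsq.ne' hsa.ne', Real.log_sqrt hq, Real.log_sqrt ha] at h1
  have h2 : a * (√q / √a) = √a * √q := by
    field_simp
    rw [Real.sq_sqrt ha]
  have h3 := mul_le_mul_of_nonneg_left h1 ha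
  have h4 := Real.sq_sqrt ha
  have h5 := Real.sq_sqrt hq
  nlinarith

lemma walkEntropy_le (hS : S.Nonempty) (n : ℕ) :
    walkEntropy S n ≤ Real.log (S ^ n).card := by
  have hN : 0 < ((S ^ n).card : ℝ) := by exact_mod_cast (hS.pow).card_pos
  set N : ℝ := ((S ^ n).card : ℝ)
  have key : ∀ x ∈ S ^ n, Real.negMulLog (walkMass S n x) ≤
      walkMass S n x * Real.log N - walkMass S n x + N⁻¹ := by
    intro x _
    have := (sq_nonneg _).trans (sq_sqrt_sub_sqrt_le (walkMass_nonneg (S := S) n x)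
      (inv_nonneg.2 hN.le) (fun h => absurd h (inv_ne_zero hN.ne')))
    rw [Real.log_inv] at this
    rw [Real.negMulLog]
    linarith
  refine (Finset.sum_le_sum key).trans ?_
  rw [Finset.sum_add_distrib, Finset.sum_sub_distrib, ← Finset.sum_mul, sum_walkMass hS,
    Finset.sum_const, nsmul_eq_mul, mul_inv_cancel₀ hN.ne']
  linarith

lemma sum_sq_sqrt_walkMass_le (hS : S.Nonempty) (n : ℕ) :
    ∑ s ∈ S, ∑ x ∈ S ^ (n + 1), (√(walkMass S n (s⁻¹ * x)) - √(walkMass S (n + 1) x)) ^ 2 ≤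
      S.card * (walkEntropy S (n + 1) - walkEntropy S n) := by
  have hc : (S.card : ℝ) ≠ 0 := by simpa using hS.ne_empty
  have hsum : ∀ x, ∑ s ∈ S, walkMass S n (s⁻¹ * x) = S.card * walkMass S (n + 1) x := by
    intro x; rw [walkMass]; field_simp
  have key : ∀ s ∈ S, ∀ x ∈ S ^ (n + 1),
      (√(walkMass S n (s⁻¹ * x)) - √(walkMass S (n + 1) x)) ^ 2 ≤
        -Real.negMulLog (walkMass S n (s⁻¹ * x))
          - walkMass S n (s⁻¹ * x) * Real.log (walkMass S (n + 1) x)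
          - walkMass S n (s⁻¹ * x) + walkMass S (n + 1) x := by
    intro s hs x _
    refine (sq_sqrt_sub_sqrt_le (walkMass_nonneg _ _) (walkMass_nonneg _ _) ?_).trans_eq ?_
    · intro h0
      have := hsum x
      rw [h0, mul_zero, Finset.sum_eq_zero_iff_of_nonneg fun _ _ => walkMass_nonneg _ _] at this
      exact this s hs
    · rw [Real.negMulLog]; ring
  refine (Finset.sum_le_sum fun s hs => Finset.sum_le_sum (key s hs)).trans_eq ?_
  simp only [Finset.sum_add_distrib, Finset.sum_sub_distrib, Finset.sum_neg_distrib]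
  have h1 : ∑ s ∈ S, ∑ x ∈ S ^ (n + 1), Real.negMulLog (walkMass S n (s⁻¹ * x)) =
      S.card * walkEntropy S n := by
    rw [Finset.sum_congr rfl fun s hs => sum_walkMass_shift _ (by simp) n hs]
    simp [walkEntropy]
  have h2 : ∑ s ∈ S, ∑ x ∈ S ^ (n + 1), walkMass S n (s⁻¹ * x) = S.card := by
    rw [Finset.sum_congr rfl fun s hs => sum_walkMass_shift (fun t => t) rfl n hs]
    simp [sum_walkMass hS]
  have h3 : ∑ s ∈ S, ∑ x ∈ S ^ (n + 1),
      walkMass S n (s⁻¹ * x) * Real.log (walkMass S (n + 1) x) =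
        -(S.card * walkEntropy S (n + 1)) := by
    rw [Finset.sum_comm, walkEntropy, Finset.mul_sum, ← Finset.sum_neg_distrib]
    refine Finset.sum_congr rfl fun x _ => ?_
    rw [← Finset.sum_mul, hsum, Real.negMulLog]; ring
  rw [h1, h2, h3, sum_walkMass hS]
  simp
  ring

lemma sq_walk_sub_walk_le (hS : S.Nonempty) (n : ℕ) {s : G} (hs : s ∈ S) (F : G → ℝ) :
    (walk S n (fun x => F (s * x)) - walk S (n + 1) F) ^ 2 ≤
      2 * S.card * (S.card + 1) * (walkEntropy S (n + 1) - walkEntropy S n) *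
        walk S (n + 1) fun x => F x ^ 2 := by
  have hc : (0 : ℝ) < S.card := by exact_mod_cast hS.card_pos
  have hshift : ∀ F : G → ℝ, walk S n (fun x => F (s * x)) =
      ∑ x ∈ S ^ (n + 1), walkMass S n (s⁻¹ * x) * F x := by
    intro F
    rw [walk_eq_sum n _ (inv_smul_pow_subset hs subset_rfl)]
    refine Finset.sum_bij (fun x _ => s * x) ?_ ?_ ?_ ?_
    · intro x hx; simpa [Finset.mem_inv_smul_finset_iff] using hx
    · simp
    · intro y hy
      exact ⟨s⁻¹ * y, by simpa [Finset.mem_inv_smul_finset_iff] using hy, by group⟩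
    · simp
  have hE : ∑ x ∈ S ^ (n + 1), (√(walkMass S n (s⁻¹ * x)) - √(walkMass S (n + 1) x)) ^ 2 ≤
      S.card * (walkEntropy S (n + 1) - walkEntropy S n) :=
    (Finset.single_le_sum (f := fun s => ∑ x ∈ S ^ (n + 1),
      (√(walkMass S n (s⁻¹ * x)) - √(walkMass S (n + 1) x)) ^ 2)
      (fun _ _ => Finset.sum_nonneg fun _ _ => sq_nonneg _) hs).trans
      (sum_sq_sqrt_walkMass_le hS n)
  have hW : walk S n (fun x => F (s * x) ^ 2) ≤ S.card * walk S (n + 1) fun x => F x ^ 2 := by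
    have : walk S (n + 1) (fun x => F x ^ 2) =
      (S.card : ℝ)⁻¹ * ∑ t ∈ S, walk S n (fun x => F (t * x) ^ 2) := rfl
    rw [this, mul_inv_cancel_left₀ hc.ne']
    exact Finset.single_le_sum (f := fun t => walk S n (fun x => F (t * x) ^ 2))
      (fun _ _ => walk_nonneg (fun _ => sq_nonneg _) n) hs
  have hsq : ∑ x ∈ S ^ (n + 1),
      ((√(walkMass S n (s⁻¹ * x)) + √(walkMass S (n + 1) x)) * F x) ^ 2 ≤
        2 * (S.card + 1) * walk S (n + 1) fun x => F x ^ 2 := by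
    have : ∑ x ∈ S ^ (n + 1),
      ((√(walkMass S n (s⁻¹ * x)) + √(walkMass S (n + 1) x)) * F x) ^ 2 ≤
        2 * (walk S n (fun x => F (s * x) ^ 2) + walk S (n + 1) fun x => F x ^ 2) := by
      rw [hshift (fun x => F x ^ 2), walk_eq_sum (n + 1) _ subset_rfl, ← Finset.sum_add_distrib,
        Finset.mul_sum]
      refine Finset.sum_le_sum fun x _ => ?_
      rw [mul_pow, smul_eq_mul, ← add_mul, ← mul_assoc]
      refine mul_le_mul_of_nonneg_right ?_ (sq_nonneg _)
      have h4 := Real.sq_sqrt (walkMass_nonneg (S := S) n (s⁻¹ * x))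
      have h5 := Real.sq_sqrt (walkMass_nonneg (S := S) (n + 1) x)
      nlinarith [sq_nonneg (√(walkMass S n (s⁻¹ * x)) - √(walkMass S (n + 1) x))]
    linarith
  have hdiff : walk S n (fun x => F (s * x)) - walk S (n + 1) F = ∑ x ∈ S ^ (n + 1),
      (√(walkMass S n (s⁻¹ * x)) - √(walkMass S (n + 1) x)) *
        ((√(walkMass S n (s⁻¹ * x)) + √(walkMass S (n + 1) x)) * F x) := by
    rw [hshift, walk_eq_sum (n + 1) _ subset_rfl, ← Finset.sum_sub_distrib]
    refine Finset.sum_congr rfl fun x _ => ?_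
    have h4 := Real.sq_sqrt (walkMass_nonneg (S := S) n (s⁻¹ * x))
    have h5 := Real.sq_sqrt (walkMass_nonneg (S := S) (n + 1) x)
    rw [smul_eq_mul]
    linear_combination (-F x) * h4 + F x * h5
  rw [hdiff]
  refine (Finset.sum_mul_sq_le_sq_mul_sq _ _ _).trans ?_
  refine (mul_le_mul hE hsq (Finset.sum_nonneg fun _ _ => sq_nonneg _) ?_).trans_eq (by ring)
  exact (Finset.sum_nonneg fun _ _ => sq_nonneg _).trans hE

lemma exists_frequently_walkEntropy_sub_le (hS : S.Nonempty) {C d : ℕ}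
    (hC : ∀ n, (S ^ n).card ≤ C * (n + 1) ^ d) :
    ∃ᶠ n : ℕ in Filter.atTop,
      (walkEntropy S (n + 1) - walkEntropy S n) * (n + 1 : ℝ) ≤ d + 1 := by
  intro h
  obtain ⟨N, hN⟩ := Filter.eventually_atTop.1 h
  set g : ℕ → ℝ := fun n => walkEntropy S n - (d + 1) * Real.log (n + 1) with hg
  have hmono : ∀ n ≥ N, g N ≤ g n := by
    intro n hn
    induction n, hn using Nat.le_induction with
    | base => rfl
    | succ n hn ih =>
      refine ih.trans ?_
      have h1 := not_le.1 (hN n hn)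
      have hn0 : (0 : ℝ) < n + 1 := by positivity
      have h2 : Real.log (n + 1 + 1) - Real.log (n + 1) ≤ 1 / (n + 1) := by
        rw [← Real.log_div (by positivity) hn0.ne']
        refine (Real.log_le_sub_one_of_pos (by positivity)).trans_eq ?_
        field_simp; ring
      have h3 : ((d : ℝ) + 1) * (1 / (n + 1)) ≤ walkEntropy S (n + 1) - walkEntropy S n := by
        rw [mul_one_div, div_le_iff₀ hn0]
        exact h1.le
      have h4 := mul_le_mul_of_nonneg_left h2 (by positivity : (0 : ℝ) ≤ d + 1)
      simp only [hg, Nat.cast_add, Nat.cast_one]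
      linarith
  have hC0 : 0 < C := by
    rcases Nat.eq_zero_or_pos C with h0 | h0
    · have := hC 0
      simp [h0] at this
    · exact h0
  have hle : ∀ n ≥ N, Real.log (n + 1) ≤ Real.log C - g N := by
    intro n hn
    have h1 := walkEntropy_le hS n
    have h2 : Real.log (S ^ n).card ≤ Real.log C + d * Real.log (n + 1) := by
      rw [← Real.log_pow, ← Real.log_mul (by positivity) (by positivity)]
      refine Real.log_le_log (by exact_mod_cast (hS.pow).card_pos) ?_
      exact_mod_cast hC n
    have h3 := hmono n hn
    simp only [hg] at h3 ⊢
    linarith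
  have htend : Filter.Tendsto (fun n : ℕ => Real.log ((n : ℝ) + 1)) Filter.atTop Filter.atTop :=
    Real.tendsto_log_atTop.comp
      (Filter.tendsto_atTop_add_const_right _ _ tendsto_natCast_atTop_atTop)
  obtain ⟨n, hn, hn'⟩ := ((Filter.eventually_ge_atTop N).and
    (htend.eventually_gt_atTop (Real.log C - g N))).exists
  exact absurd (hle n hn) (not_le.2 hn')

end Walk

section HilbertSchmidt

open UniformSpace (Completion)
open scoped TensorProduct InnerProductSpace

variable {H : Type*} [NormedAddCommGroup H] [InnerProductSpace ℝ H]

/-- A pure tensor, in the Hilbert space tensor square of `H`. -/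
noncomputable def hilbertTmul (v w : H) : Completion (H ⊗[ℝ] H) := ((v ⊗ₜ[ℝ] w : H ⊗[ℝ] H) :)

lemma inner_hilbertTmul (v w v' w' : H) :
    ⟪hilbertTmul v w, hilbertTmul v' w'⟫_ℝ = ⟪v, v'⟫_ℝ * ⟪w, w'⟫_ℝ := by
  simp [hilbertTmul, Completion.inner_coe]

lemma norm_hilbertTmul (v w : H) : ‖hilbertTmul v w‖ = ‖v‖ * ‖w‖ := by
  simp [hilbertTmul, Completion.norm_coe]

lemma hilbertTmul_add (v w w' : H) :
    hilbertTmul v (w + w') = hilbertTmul v w + hilbertTmul v w' := by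
  simp [hilbertTmul, TensorProduct.tmul_add, Completion.coe_add]

lemma add_hilbertTmul (v v' w : H) :
    hilbertTmul (v + v') w = hilbertTmul v w + hilbertTmul v' w := by
  simp [hilbertTmul, TensorProduct.add_tmul, Completion.coe_add]

lemma smul_hilbertTmul (r : ℝ) (v w : H) :
    hilbertTmul (r • v) w = r • hilbertTmul v w := by
  simp [hilbertTmul, ← TensorProduct.smul_tmul', Completion.coe_smul]

lemma hilbertTmul_smul (r : ℝ) (v w : H) :
    hilbertTmul v (r • w) = r • hilbertTmul v w := by
  simp [hilbertTmul, Completion.coe_smul]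

/-- The tensor square of an isometry, as an operator on the Hilbert space tensor square. -/
noncomputable def hilbertTensorSquare (f : H →ₗᵢ[ℝ] H) :
    Completion (H ⊗[ℝ] H) →L[ℝ] Completion (H ⊗[ℝ] H) :=
  (TensorProduct.mapIsometry f f).toContinuousLinearMap.completion

lemma hilbertTensorSquare_hilbertTmul (f : H →ₗᵢ[ℝ] H) (v w : H) :
    hilbertTensorSquare f (hilbertTmul v w) = hilbertTmul (f v) (f w) := by
  simp [hilbertTensorSquare, hilbertTmul, ContinuousLinearMap.completion_apply_coe]

lemma norm_hilbertTensorSquare (f : H →ₗᵢ[ℝ] H) (x : Completion (H ⊗[ℝ] H)) :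
    ‖hilbertTensorSquare f x‖ = ‖x‖ := by
  induction x using Completion.induction_on with
  | hp => exact isClosed_eq (by fun_prop) (by fun_prop)
  | ih x =>
    simp [hilbertTensorSquare, ContinuousLinearMap.completion_apply_coe, Completion.norm_coe]

lemma inner_hilbertTensorSquare (f : H →ₗᵢ[ℝ] H) (x y : Completion (H ⊗[ℝ] H)) :
    ⟪hilbertTensorSquare f x, hilbertTensorSquare f y⟫_ℝ = ⟪x, y⟫_ℝ :=
  (LinearIsometry.mk (hilbertTensorSquare f).toLinearMap (norm_hilbertTensorSquare f)).inner_map_map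
    x y

/-- A Hilbert space tensor defines a compact operator. -/
lemma exists_isCompactOperator_inner [CompleteSpace H] (Q : Completion (H ⊗[ℝ] H)) :
    ∃ A : H →L[ℝ] H, IsCompactOperator A ∧ ∀ v w, ⟪A v, w⟫_ℝ = ⟪Q, hilbertTmul v w⟫_ℝ := by
  have key : ∀ x : H ⊗[ℝ] H, ∃ A : H →L[ℝ] H, IsCompactOperator A ∧
      ∀ v w, ⟪A v, w⟫_ℝ = ⟪(x : Completion (H ⊗[ℝ] H)), hilbertTmul v w⟫_ℝ := by
    intro x
    induction x with
    | zero => exact ⟨0, isCompactOperator_zero, by simp [Completion.coe_zero]⟩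
    | tmul a b =>
      refine ⟨(innerSL ℝ a).smulRight b, ?_, fun v w => ?_⟩
      · have : IsCompactOperator (innerSL ℝ a) :=
          isCompactOperator_of_locallyCompactSpace_dom _
        exact this.clm_comp (ContinuousLinearMap.toSpanSingleton ℝ b)
      · rw [← hilbertTmul, inner_hilbertTmul]
        simp [inner_smul_left]
    | add x y hx hy =>
      obtain ⟨A, hA, hA'⟩ := hx
      obtain ⟨B, hB, hB'⟩ := hy
      refine ⟨A + B, hA.add hB, fun v w => ?_⟩
      simp [inner_add_left, hA', hB', Completion.coe_add]
  let B (Q : Completion (H ⊗[ℝ] H)) : H →L[ℝ] H →L[ℝ] ℝ :=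
    LinearMap.mkContinuous₂
      (LinearMap.mk₂ ℝ (fun v w => ⟪Q, hilbertTmul v w⟫_ℝ)
        (by simp [add_hilbertTmul, inner_add_right])
        (by simp [smul_hilbertTmul, inner_smul_right])
        (by simp [hilbertTmul_add, inner_add_right])
        (by simp [hilbertTmul_smul, inner_smul_right])) ‖Q‖ (fun v w => by
          rw [mul_assoc, ← norm_hilbertTmul]; exact norm_inner_le_norm (𝕜 := ℝ) Q (hilbertTmul v w))
  let A (Q : Completion (H ⊗[ℝ] H)) : H →L[ℝ] H := InnerProductSpace.continuousLinearMapOfBilin (B Q)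
  have hA : ∀ Q v w, ⟪A Q v, w⟫_ℝ = ⟪Q, hilbertTmul v w⟫_ℝ := fun Q v w =>
    InnerProductSpace.continuousLinearMapOfBilin_apply (B Q) v w
  have huniq : ∀ Q (T : H →L[ℝ] H), (∀ v w, ⟪T v, w⟫_ℝ = ⟪Q, hilbertTmul v w⟫_ℝ) → T = A Q := by
    intro Q T hT
    ext v
    exact ext_inner_right ℝ fun w => by rw [hT, hA]
  have hlip : LipschitzWith 1 A := by
    refine LipschitzWith.of_dist_le_mul fun P Q => ?_
    rw [dist_eq_norm, dist_eq_norm, NNReal.coe_one, one_mul]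
    refine ContinuousLinearMap.opNorm_le_bound _ (norm_nonneg _) fun v => ?_
    set u := (A P - A Q) v with hu
    have h1 : ‖u‖ * ‖u‖ ≤ ‖P - Q‖ * (‖v‖ * ‖u‖) := by
      have : ⟪u, u⟫_ℝ = ⟪P - Q, hilbertTmul v u⟫_ℝ := by
        nth_rw 1 [hu]
        rw [sub_apply, inner_sub_left, hA, hA, inner_sub_left]
      rw [← real_inner_self_eq_norm_mul_norm, this, ← norm_hilbertTmul]
      exact real_inner_le_norm _ _
    rcases (norm_nonneg u).eq_or_lt with h0 | h0
    · rw [← h0]; positivity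
    · exact le_of_mul_le_mul_right (by linarith) h0
  refine ⟨A Q, ?_, hA Q⟩
  induction Q using Completion.induction_on with
  | hp => exact isClosed_setOfPred_isCompactOperator.preimage hlip.continuous
  | ih x =>
    obtain ⟨T, hT, hT'⟩ := key x
    rwa [← huniq _ T hT']

end HilbertSchmidt

section Walk

variable {G E E' : Type*} [Group G] [AddCommGroup E] [Module ℝ E] [AddCommGroup E'] [Module ℝ E']
  {S : Finset G}

lemma walk_add (n : ℕ) (F F' : G → E) :
    walk S n (fun x => F x + F' x) = walk S n F + walk S n F' := by
  induction n generalizing F F' with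
  | zero => rfl
  | succ n ih => simp [walk, ih, Finset.sum_add_distrib]

lemma walk_map (L : E →ₗ[ℝ] E') (n : ℕ) (F : G → E) :
    walk S n (fun x => L (F x)) = L (walk S n F) := by
  induction n generalizing F with
  | zero => rfl
  | succ n ih => simp [walk, ih]

end Walk

section Fixed

open scoped InnerProductSpace

variable {ι H : Type*} [NormedAddCommGroup H] [InnerProductSpace ℝ H]

lemma eq_of_sum_eq_card_smul {s : Finset ι} {P : ι → H → H} (hP : ∀ i x, ‖P i x‖ = ‖x‖) {x : H}
    (h : ∑ i ∈ s, P i x = (s.card : ℝ) • x) : ∀ i ∈ s, P i x = x := by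
  have hsum : ∑ i ∈ s, ‖P i x - x‖ ^ 2 = 0 := by
    have h1 : ∀ i ∈ s, ‖P i x - x‖ ^ 2 = 2 * ‖x‖ ^ 2 - 2 * ⟪P i x, x⟫_ℝ := fun i _ => by
      rw [norm_sub_sq_real, hP]; ring
    rw [Finset.sum_congr rfl h1, Finset.sum_sub_distrib, ← Finset.mul_sum, ← Finset.mul_sum,
      ← sum_inner, h, inner_smul_left, real_inner_self_eq_norm_sq]
    simp
  intro i hi
  rw [Finset.sum_eq_zero_iff_of_nonneg fun _ _ => by positivity] at hsum
  simpa [sub_eq_zero] using hsum i hi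

end Fixed

section Cocycle

open scoped InnerProductSpace TensorProduct
open UniformSpace (Completion)
open Filter Topology

variable {G H : Type*} [Group G] [NormedAddCommGroup H] [InnerProductSpace ℝ H] {S : Finset G}

lemma isometricAction_mul_apply (π : G →* (H →ₗᵢ[ℝ] H)) (x y : G) (v : H) :
    π (x * y) v = π x (π y v) := by
  rw [map_mul]; rfl

lemma isometricAction_one_apply (π : G →* (H →ₗᵢ[ℝ] H)) (v : H) : π 1 v = v := by
  rw [map_one]; rfl

lemma inner_isometricAction (π : G →* (H →ₗᵢ[ℝ] H)) (g : G) (u v : H) :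
    ⟪π g u, v⟫_ℝ = ⟪u, π g⁻¹ v⟫_ℝ := by
  rw [← (π g⁻¹).inner_map_map, ← isometricAction_mul_apply, inv_mul_cancel,
    isometricAction_one_apply]

lemma walk_cocycle (π : G →* (H →ₗᵢ[ℝ] H)) (b : G → H) (hb : ∀ x y, b (x * y) = b x + π x (b y))
    (hS : S.Nonempty) (h0 : ∑ s ∈ S, b s = 0) (n : ℕ) : walk S n b = 0 := by
  have hb1 : b 1 = 0 := by simpa using hb 1 1
  induction n with
  | zero => exact hb1
  | succ n ih =>
    have h : ∀ s ∈ S, walk S n (fun x => b (s * x)) = b s := fun s _ => by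
      simp_rw [hb s]
      rw [walk_add, walk_const hS, add_eq_left]
      exact (walk_map (π s).toLinearMap n b).trans (by rw [ih, map_zero])
    rw [walk, Finset.sum_congr rfl h, h0, smul_zero]

/-- The normalised covariance of a harmonic cocycle along the random walk converges to an
invariant tensor. -/
lemma exists_tendsto_walk_cocycle [CompleteSpace H] (π : G →* (H →ₗᵢ[ℝ] H)) (b : G → H)
    (hb : ∀ x y, b (x * y) = b x + π x (b y)) (hS : S.Nonempty) (h0 : ∑ s ∈ S, b s = 0) :
    ∃ Q : Completion (H ⊗[ℝ] H),
      Tendsto (fun n : ℕ => (n : ℝ)⁻¹ • walk S n fun x => hilbertTmul (b x) (b x)) atTop (𝓝 Q) ∧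
      ∀ s ∈ S, hilbertTensorSquare (π s) Q = Q := by
  have hc : (0 : ℝ) < S.card := by exact_mod_cast hS.card_pos
  set P : G → Completion (H ⊗[ℝ] H) →L[ℝ] Completion (H ⊗[ℝ] H) :=
    fun s => hilbertTensorSquare (π s) with hP
  set M : Completion (H ⊗[ℝ] H) →L[ℝ] Completion (H ⊗[ℝ] H) :=
    (S.card : ℝ)⁻¹ • ∑ s ∈ S, P s with hM
  set T : Completion (H ⊗[ℝ] H) := (S.card : ℝ)⁻¹ • ∑ s ∈ S, hilbertTmul (b s) (b s) with hT
  have hMapp : ∀ x, M x = (S.card : ℝ)⁻¹ • ∑ s ∈ S, P s x := fun x => by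
    simp [hM]
  have hM1 : ‖M‖ ≤ 1 := by
    refine ContinuousLinearMap.opNorm_le_bound _ zero_le_one fun x => ?_
    rw [hMapp, norm_smul, norm_inv, Real.norm_natCast, one_mul, inv_mul_le_iff₀ hc]
    refine (norm_sum_le _ _).trans ?_
    simp [hP, norm_hilbertTensorSquare]
  have hrec : ∀ n, walk S (n + 1) (fun x => hilbertTmul (b x) (b x)) =
      T + M (walk S n fun x => hilbertTmul (b x) (b x)) := by
    intro n
    rw [walk, hT, hMapp, ← smul_add, ← Finset.sum_add_distrib]
    congr 1
    refine Finset.sum_congr rfl fun s _ => ?_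
    have h : ∀ x, hilbertTmul (b (s * x)) (b (s * x)) = hilbertTmul (b s) (b s) +
        (hilbertTmul (b s) (π s (b x)) + (hilbertTmul (π s (b x)) (b s) +
          P s (hilbertTmul (b x) (b x)))) := fun x => by
      rw [hb, hilbertTmul_add, add_hilbertTmul, add_hilbertTmul, hP,
        hilbertTensorSquare_hilbertTmul]
      abel
    simp_rw [h]
    rw [walk_add, walk_add, walk_add, walk_const hS]
    have e1 : walk S n (fun x => hilbertTmul (b s) (π s (b x))) = 0 := by
      have := walk_map (S := S) (IsLinearMap.mk' (fun v => hilbertTmul (b s) (π s v))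
        ⟨by simp [hilbertTmul_add], by simp [hilbertTmul_smul]⟩) n b
      rw [walk_cocycle π b hb hS h0, map_zero] at this
      exact this
    have e2 : walk S n (fun x => hilbertTmul (π s (b x)) (b s)) = 0 := by
      have := walk_map (S := S) (IsLinearMap.mk' (fun v => hilbertTmul (π s v) (b s))
        ⟨by simp [add_hilbertTmul], by simp [smul_hilbertTmul]⟩) n b
      rw [walk_cocycle π b hb hS h0, map_zero] at this
      exact this
    rw [e1, e2, zero_add, zero_add]
    congr 1
    exact walk_map (P s).toLinearMap n _
  have hb1 : b 1 = 0 := by simpa using hb 1 1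
  have hbirk : ∀ n, walk S n (fun x => hilbertTmul (b x) (b x)) = birkhoffSum M _root_.id n T := by
    intro n
    induction n with
    | zero => simp [walk, hb1, hilbertTmul, Completion.coe_zero]
    | succ n ih =>
      rw [hrec, ih, birkhoffSum_succ', id]
      congr 1
      simp only [birkhoffSum, map_sum, id, ← Function.iterate_succ_apply' M]
      exact Finset.sum_congr rfl fun k _ => Function.iterate_succ_apply ..
  obtain ⟨Q, hMQ, hlim⟩ : ∃ Q, M Q = Q ∧
      Tendsto (birkhoffAverage ℝ M _root_.id · T) atTop (𝓝 Q) := by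
    refine ⟨_, ?_, M.tendsto_birkhoffAverage_orthogonalProjection hM1 T⟩
    exact Subtype.prop (p := fun x => x ∈ M.toLinearMap.eqLocus 1) _
  refine ⟨Q, ?_, ?_⟩
  · refine hlim.congr fun n => ?_
    rw [birkhoffAverage, hbirk]
  · refine eq_of_sum_eq_card_smul (P := fun s => P s) (fun s => norm_hilbertTensorSquare (π s)) ?_
    nth_rw 2 [← hMQ]
    rw [hMapp, smul_smul, mul_inv_cancel₀ hc.ne', one_smul]

lemma inner_cocycle_eq_zero (π : G →* (H →ₗᵢ[ℝ] H)) (b : G → H)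
    (hb : ∀ x y, b (x * y) = b x + π x (b y)) (hgen : Subgroup.closure (S : Set G) = ⊤)
    (V : Submodule ℝ H) (hV : ∀ g, ∀ v ∈ V, π g v ∈ V) (h : ∀ s ∈ S, ∀ v ∈ V, ⟪b s, v⟫_ℝ = 0)
    (x : G) : ∀ v ∈ V, ⟪b x, v⟫_ℝ = 0 := by
  have hb1 : b 1 = 0 := by simpa using hb 1 1
  have hx : x ∈ Subgroup.closure (S : Set G) := hgen ▸ Subgroup.mem_top x
  induction hx using Subgroup.closure_induction with
  | mem x hx => exact h x hx
  | one => simp [hb1]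
  | mul x y _ _ hx hy =>
    intro v hv
    rw [hb, inner_add_left, hx v hv, inner_isometricAction, hy _ (hV _ v hv), zero_add]
  | inv x _ hx =>
    intro v hv
    have h2 : b x⁻¹ = - π x⁻¹ (b x) := by
      have := hb x⁻¹ x
      rw [inv_mul_cancel, hb1] at this
      exact eq_neg_of_add_eq_zero_left this.symm
    rw [h2, inner_neg_left, inner_isometricAction, inv_inv, hx _ (hV _ v hv), neg_zero]

/-- In a group of polynomial growth, a non-zero harmonic cocycle has a non-zero component in a
finite-dimensional invariant subspace. -/
theorem exists_finiteDimensional_inner_cocycle_ne_zero [DecidableEq G] [CompleteSpace H]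
    (π : G →* (H →ₗᵢ[ℝ] H)) (b : G → H)
    (hb : ∀ x y, b (x * y) = b x + π x (b y)) (hgen : Subgroup.closure (S : Set G) = ⊤)
    (h0 : ∑ s ∈ S, b s = 0) (hne : ∃ s ∈ S, b s ≠ 0)
    {C d : ℕ} (hC : ∀ n, (S ^ n).card ≤ C * (n + 1) ^ d) :
    ∃ V : Submodule ℝ H, FiniteDimensional ℝ V ∧ (∀ g, ∀ v ∈ V, π g v ∈ V) ∧
      ∃ s ∈ S, ∃ v ∈ V, ⟪b s, v⟫_ℝ ≠ 0 := by
  obtain ⟨s₀, hs₀, hbs₀⟩ := hne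
  have hS : S.Nonempty := ⟨s₀, hs₀⟩
  obtain ⟨Q, hQ, hinv⟩ := exists_tendsto_walk_cocycle π b hb hS h0
  obtain ⟨A, hAc, hA⟩ := exists_isCompactOperator_inner Q
  have hq : ∀ v w, Tendsto (fun n : ℕ => (n : ℝ)⁻¹ * walk S n fun x => ⟪b x, v⟫_ℝ * ⟪b x, w⟫_ℝ)
      atTop (𝓝 ⟪A v, w⟫_ℝ) := by
    intro v w
    have h1 := (hQ.inner (tendsto_const_nhds (x := hilbertTmul v w)) :
      Tendsto (fun n : ℕ => ⟪_, _⟫_ℝ) atTop _)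
    rw [hA]
    refine h1.congr fun n => ?_
    have h2 := walk_map (S := S) (innerSL ℝ (hilbertTmul v w)).toLinearMap n
      fun x => hilbertTmul (b x) (b x)
    rw [inner_smul_left, real_inner_comm]
    simp only [ContinuousLinearMap.coe_coe, innerSL_apply_apply, inner_hilbertTmul] at h2
    rw [← h2]
    simp [real_inner_comm]
  have hsymm : (A : H →ₗ[ℝ] H).IsSymmetric := by
    intro v w
    have h1 := hq w v
    simp_rw [mul_comm ⟪_, w⟫_ℝ] at h1
    have := tendsto_nhds_unique (hq v w) h1
    simpa [real_inner_comm] using this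
  have hcomm : ∀ g v, A (π g v) = π g (A v) := by
    intro g
    have hg : g ∈ Subgroup.closure (S : Set G) := hgen ▸ Subgroup.mem_top g
    induction hg using Subgroup.closure_induction with
    | mem s hs =>
      intro v
      refine ext_inner_right ℝ fun w => ?_
      rw [inner_isometricAction, hA, hA, ← inner_hilbertTensorSquare (π s) Q (hilbertTmul v _),
        hinv s hs, hilbertTensorSquare_hilbertTmul, ← isometricAction_mul_apply, mul_inv_cancel,
        isometricAction_one_apply]
    | one => simp
    | mul x y _ _ hx hy =>
      intro v
      rw [isometricAction_mul_apply, hx, hy, isometricAction_mul_apply]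
    | inv x _ hx =>
      intro v
      apply (π x).injective
      rw [← hx, ← isometricAction_mul_apply, ← isometricAction_mul_apply, mul_inv_cancel,
        isometricAction_one_apply, isometricAction_one_apply]
  have hA0 : A ≠ 0 := by
    rintro rfl
    refine hbs₀ (ext_inner_right ℝ fun v => ?_)
    rw [inner_zero_left]
    by_contra hF
    have hF2 : 0 < ⟪b s₀, v⟫_ℝ ^ 2 := by positivity
    set K : ℝ := 2 * S.card * (S.card + 1) with hK
    have h1 := ((hq v v).comp (tendsto_add_atTop_nat 1)).const_mul (K * (d + 1))
    have h2 : ∀ᶠ n : ℕ in atTop, K * (d + 1) * ((↑(n + 1))⁻¹ *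
        walk S (n + 1) fun x => ⟪b x, v⟫_ℝ * ⟪b x, v⟫_ℝ) < ⟪b s₀, v⟫_ℝ ^ 2 :=
      h1.eventually_lt_const (by simpa using hF2)
    obtain ⟨n, hn, hn'⟩ := ((exists_frequently_walkEntropy_sub_le hS hC).and_eventually h2).exists
    have h3 := sq_walk_sub_walk_le hS n hs₀ fun x => ⟪b x, v⟫_ℝ
    have hz : ∀ (L : H →ₗ[ℝ] ℝ) n, walk S n (fun x => L (b x)) = 0 := fun L n => by
      rw [walk_map, walk_cocycle π b hb hS h0, map_zero]
    have h4 : walk S n (fun x => ⟪b (s₀ * x), v⟫_ℝ) = ⟪b s₀, v⟫_ℝ := by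
      simp_rw [hb s₀, inner_add_left]
      rw [walk_add, walk_const hS, add_eq_left]
      exact hz (((innerSL ℝ).flip v).toLinearMap ∘ₗ (π s₀).toLinearMap) n
    have h5 : walk S (n + 1) (fun x => ⟪b x, v⟫_ℝ) = 0 :=
      hz ((innerSL ℝ).flip v).toLinearMap (n + 1)
    rw [h4, h5, sub_zero] at h3
    simp_rw [← pow_two] at hn'
    have h6 : 0 ≤ walk S (n + 1) fun x => ⟪b x, v⟫_ℝ ^ 2 :=
      walk_nonneg (fun x => by positivity) _
    refine (h3.trans ?_).not_gt hn'
    have h7 : (0 : ℝ) < n + 1 := by positivity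
    calc K * (walkEntropy S (n + 1) - walkEntropy S n) * walk S (n + 1) (fun x => ⟪b x, v⟫_ℝ ^ 2)
        = K * ((walkEntropy S (n + 1) - walkEntropy S n) * (n + 1)) *
          ((↑(n + 1))⁻¹ * walk S (n + 1) (fun x => ⟪b x, v⟫_ℝ ^ 2)) := by
          push_cast; field_simp
      _ ≤ _ := by gcongr
  obtain ⟨μ, hμ, hμ0⟩ : ∃ μ, Module.End.HasEigenvalue (A : Module.End ℝ H) μ ∧ μ ≠ 0 := by
    by_contra! h
    exact hA0 ((ContinuousLinearMap.eq_zero_of_forall_hasEigenvalue_eq_zero hAc hsymm).1 h)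
  have hVinv : ∀ g, ∀ v ∈ Module.End.eigenspace (A : Module.End ℝ H) μ,
      π g v ∈ Module.End.eigenspace (A : Module.End ℝ H) μ := by
    intro g v hv
    rw [Module.End.mem_eigenspace_iff] at hv ⊢
    have : A v = μ • v := hv
    change A (π g v) = _
    rw [hcomm, this, map_smul]
  refine ⟨_, ContinuousLinearMap.finite_dimensional_eigenspace hAc μ hμ0, hVinv, ?_⟩
  by_contra! h
  obtain ⟨v, hv, hv0⟩ := hμ.exists_hasEigenvector
  have h1 := hq v v
  simp_rw [inner_cocycle_eq_zero π b hb hgen _ hVinv h _ v hv, mul_zero] at h1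
  simp_rw [walk_const hS, mul_zero] at h1
  have h2 := tendsto_nhds_unique h1 tendsto_const_nhds
  have h3 : A v = μ • v := Module.End.mem_eigenspace_iff.1 hv
  rw [h3, inner_smul_left, real_inner_self_eq_norm_sq] at h2
  simp [hμ0, hv0] at h2

end Cocycle

section Ultralimit

open scoped InnerProductSpace
open Filter Topology UniformSpace

universe u v

variable {G : Type*} [Group G] {H : Type u} [NormedAddCommGroup H] [InnerProductSpace ℝ H]

lemma exists_tendsto_hyperfilter {f : ℕ → ℝ} {c : ℝ} (hf : ∀ n, |f n| ≤ c) :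
    ∃ l, Tendsto f (hyperfilter ℕ) (𝓝 l) := by
  obtain ⟨l, -, hl⟩ := (isCompact_closedBall (0 : ℝ) c).ultrafilter_le_nhds
    ((hyperfilter ℕ).map f) (by
      rw [le_principal_iff]
      exact Filter.mem_map.2 (Filter.univ_mem' fun n => by simpa using hf n))
  exact ⟨l, hl⟩

/-- An ultralimit of a sequence of maps to Hilbert spaces with isometric actions. -/
lemma exists_isometricAction_ultralimit {E : Type v} [AddCommGroup E] [Module ℝ E]
    (ρ : G →* (H →ₗᵢ[ℝ] H)) (B : ℕ → E →ₗ[ℝ] H) (hB : ∀ x, ∃ c, ∀ n, ‖B n x‖ ≤ c)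
    (T : G → E →ₗ[ℝ] E) (hT : ∀ n g x, B n (T g x) = ρ g (B n x)) :
    ∃ (K : Type v) (_ : NormedAddCommGroup K) (_ : InnerProductSpace ℝ K) (_ : CompleteSpace K)
      (π : G →* (K →ₗᵢ[ℝ] K)) (j : E →ₗ[ℝ] K), (∀ g x, π g (j x) = j (T g x)) ∧
      ∀ x, Tendsto (fun n => ‖B n x‖) (hyperfilter ℕ) (𝓝 ‖j x‖) := by
  have hex : ∀ x y, ∃ l, Tendsto (fun n => ⟪B n x, B n y⟫_ℝ) (hyperfilter ℕ) (𝓝 l) := by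
    intro x y
    obtain ⟨c, hc⟩ := hB x
    obtain ⟨c', hc'⟩ := hB y
    refine exists_tendsto_hyperfilter (c := c * c') fun n => ?_
    refine (abs_real_inner_le_norm _ _).trans ?_
    exact mul_le_mul (hc n) (hc' n) (norm_nonneg _) ((norm_nonneg _).trans (hc n))
  choose L hL using hex
  let core : PreInnerProductSpace.Core ℝ E :=
    { inner := L
      conj_inner_symm := fun x y => tendsto_nhds_unique (hL y x)
        (by simpa only [real_inner_comm] using hL x y)
      re_inner_nonneg := fun x => ge_of_tendsto (hL x x)
        (Eventually.of_forall fun n => real_inner_self_nonneg)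
      add_left := fun x y z => tendsto_nhds_unique (hL _ _) (by
        simpa only [map_add, inner_add_left] using (hL x z).add (hL y z))
      smul_left := fun x y r => tendsto_nhds_unique (hL _ _) (by
        simpa only [map_smul, inner_smul_left, conj_trivial] using (hL x y).const_mul r) }
  let : SeminormedAddCommGroup E := InnerProductSpace.Core.toSeminormedAddCommGroup (𝕜 := ℝ)
  let : InnerProductSpace ℝ E := InnerProductSpace.ofCore core
  let j : E →ₗ[ℝ] Completion E := Completion.toComplₗᵢ.toLinearMap
  have hj : DenseRange j := Completion.denseRange_coe
  have hlim : ∀ x, Tendsto (fun n => ‖B n x‖) (hyperfilter ℕ) (𝓝 ‖j x‖) := by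
    intro x
    have h1 : ‖j x‖ = √(L x x) := by
      change ‖(x : Completion E)‖ = _
      rw [Completion.norm_coe, norm_eq_sqrt_real_inner]
      rfl
    rw [h1]
    refine (hL x x).sqrt.congr fun n => ?_
    rw [real_inner_self_eq_norm_sq, Real.sqrt_sq (norm_nonneg _)]
  have heq : ∀ x y, (∀ n, B n x = B n y) → j x = j y := by
    intro x y h
    have := hlim (x - y)
    simp only [map_sub, h, sub_self, norm_zero] at this
    rw [← sub_eq_zero, ← norm_eq_zero]
    exact tendsto_nhds_unique this tendsto_const_nhds |>.trans rfl
  have hiso : ∀ g x, ‖j (T g x)‖ = ‖j x‖ := by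
    intro g x
    refine tendsto_nhds_unique (hlim _) ?_
    simpa only [hT, LinearIsometry.norm_map] using hlim x
  let P : G → Completion E →L[ℝ] Completion E := fun g => (j ∘ₗ T g).extendOfNorm j
  have hP : ∀ g x, P g (j x) = j (T g x) := fun g x =>
    LinearMap.extendOfNorm_eq hj ⟨1, fun x => by simp [hiso]⟩ x
  have hPn : ∀ g x, ‖P g x‖ = ‖x‖ := by
    intro g x
    refine hj.induction_on x (isClosed_eq (by fun_prop) (by fun_prop)) fun x => ?_
    rw [hP, hiso]
  refine ⟨Completion E, inferInstance, inferInstance, inferInstance,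
    { toFun := fun g => ⟨(P g).toLinearMap, hPn g⟩
      map_one' := ?_
      map_mul' := ?_ }, j, hP, hlim⟩
  · ext x
    refine hj.induction_on (p := fun x => P 1 x = x) x
      (isClosed_eq (by fun_prop) (by fun_prop)) fun x => ?_
    rw [hP]
    exact heq _ _ fun n => by rw [hT, isometricAction_one_apply]
  · intro g h
    ext x
    refine hj.induction_on (p := fun x => P (g * h) x = P g (P h x)) x
      (isClosed_eq (by fun_prop) (by fun_prop)) fun x => ?_
    rw [hP, hP, hP]
    exact heq _ _ fun n => by rw [hT, hT, hT, isometricAction_mul_apply]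

end Ultralimit

section RegularRepresentation

open scoped InnerProductSpace ENNReal
open Filter Topology

universe u

variable {G : Type u} [Group G]

lemma summable_norm_rpow_translate (f : lp (fun _ : G => ℝ) 2) (g : G) :
    Summable fun x => ‖f (g⁻¹ * x)‖ ^ (2 : ℝ≥0∞).toReal :=
  ((memℓp_gen_iff (by simp)).1 (lp.memℓp f)).comp_injective (mul_right_injective g⁻¹)

/-- The left regular representation on square-summable functions. -/
noncomputable def regularAction : G →* (lp (fun _ : G => ℝ) 2 →ₗᵢ[ℝ] lp (fun _ : G => ℝ) 2) where
  toFun g :=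
    { toFun := fun f => ⟨fun x => f (g⁻¹ * x), memℓp_gen (summable_norm_rpow_translate f g)⟩
      map_add' := fun f f' => by ext x; rfl
      map_smul' := fun r f => by ext x; rfl
      norm_map' := fun f => by
        rw [lp.norm_eq_tsum_rpow (by simp), lp.norm_eq_tsum_rpow (by simp)]
        congr 1
        exact (Equiv.mulLeft g⁻¹).tsum_eq fun x => ‖f x‖ ^ (2 : ℝ≥0∞).toReal }
  map_one' := by ext f x; simp
  map_mul' g h := by ext f x; simp [mul_assoc]

lemma regularAction_apply (g : G) (f : lp (fun _ : G => ℝ) 2) (x : G) :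
    regularAction g f x = f (g⁻¹ * x) := rfl

lemma eq_zero_of_regularAction_eq [Infinite G] {f : lp (fun _ : G => ℝ) 2}
    (hf : ∀ g, regularAction g f = f) : f = 0 := by
  have hconst : ∀ x, f x = f 1 := fun x => by
    conv_lhs => rw [← hf x, regularAction_apply, inv_mul_cancel]
  have h1 := (memℓp_gen_iff (by simp)).1 (lp.memℓp f)
  simp_rw [hconst] at h1
  rw [summable_const_iff] at h1
  ext x
  rw [hconst]
  simpa using h1

lemma regularAction_single [DecidableEq G] (g x : G) :
    regularAction g (lp.single 2 x (1 : ℝ)) = lp.single 2 (g * x) (1 : ℝ) := by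
  ext y
  rw [regularAction_apply]
  by_cases h : y = g * x
  · subst h; simp
  · rw [lp.single_apply_ne _ _ _ h, lp.single_apply_ne]
    rintro rfl
    exact h (by group)

end RegularRepresentation

section SpectralGap

open scoped InnerProductSpace
open Filter Topology

/-- Geometric decay of the iterates of a positive contraction with a spectral gap. -/
lemma exists_norm_sq_iterate_le {H : Type*} [NormedAddCommGroup H] [InnerProductSpace ℝ H]
    [CompleteSpace H] (L : H →L[ℝ] H) (hsymm : ∀ x y, ⟪L x, y⟫_ℝ = ⟪x, L y⟫_ℝ)
    (hpos : ∀ x, 0 ≤ ⟪L x, x⟫_ℝ) (hcontr : ∀ x, ‖L x‖ ≤ ‖x‖) (hfix : ∀ x, L x = x → x = 0)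
    {δ : ℝ} (hδ : 0 < δ) (hδ1 : δ < 1) (hgap : ∀ x, δ * ⟪x - L x, x⟫_ℝ ≤ ‖x - L x‖ ^ 2) (v : H) :
    ∃ K c : ℝ, 0 ≤ c ∧ c < 1 ∧ ∀ k, ‖L^[k] v‖ ^ 2 ≤ K * c ^ k := by
  set c := 1 - δ with hc
  have hc0 : 0 < c := by linarith
  have hc1 : c < 1 := by linarith
  set u : ℕ → H := fun k => L^[k] v with hu
  have hu1 : ∀ k, u (k + 1) = L (u k) := fun k => Function.iterate_succ_apply' L k v
  set D : ℕ → ℝ := fun k => ⟪u k - L (u k), u k⟫_ℝ with hD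
  have hDstep : ∀ k, ‖u k - L (u k)‖ ^ 2 ≤ D k - D (k + 1) := by
    intro k
    have h := hpos (u k - L (u k))
    simp only [hD, hu1]
    rw [← real_inner_self_eq_norm_sq]
    simp only [inner_sub_left, inner_sub_right, map_sub, hsymm] at h ⊢
    have := real_inner_comm (u k) (L (u k))
    have := real_inner_comm (u k) (L (L (u k)))
    linarith
  have hD0 : ∀ k, 0 ≤ D k := by
    intro k
    have h1 := real_inner_le_norm (L (u k)) (u k)
    have h2 := mul_le_mul_of_nonneg_right (hcontr (u k)) (norm_nonneg (u k))
    simp only [hD]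
    rw [inner_sub_left, real_inner_self_eq_norm_mul_norm]
    linarith
  have hDgeo : ∀ k, D k ≤ D 0 * c ^ k := by
    intro k
    induction k with
    | zero => simp
    | succ k ih =>
      have h1 := hDstep k
      have h2 := hgap (u k)
      calc D (k + 1) ≤ c * D k := by simp only [hc]; simp only [hD] at *; linarith
        _ ≤ c * (D 0 * c ^ k) := by gcongr
        _ = _ := by ring
  have hlim : Tendsto u atTop (𝓝 0) := by
    have hcauchy : CauchySeq u := by
      refine cauchySeq_of_le_geometric (√c) (√(D 0)) ?_ fun k => ?_
      · rw [Real.sqrt_lt' one_pos]; simpa using hc1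
      · rw [dist_eq_norm, hu1, ← sq_le_sq₀ (norm_nonneg _) (by positivity), mul_pow,
          Real.sq_sqrt (hD0 0), ← pow_mul, mul_comm k, pow_mul, Real.sq_sqrt hc0.le]
        linarith [hDstep k, hD0 (k + 1), hDgeo k]
    obtain ⟨x, hx⟩ := cauchySeq_tendsto_of_complete hcauchy
    have h1 : Tendsto (fun k => u (k + 1)) atTop (𝓝 (L x)) := by
      simp_rw [hu1]
      exact (L.continuous.tendsto x).comp hx
    have h2 := tendsto_nhds_unique h1 (hx.comp (tendsto_add_atTop_nat 1))
    rwa [hfix x h2] at hx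
  have hstep : ∀ k, ‖u k‖ ^ 2 - ‖u (k + 1)‖ ^ 2 ≤ 2 * D k := by
    intro k
    have h1 := norm_sub_sq_real (u k) (L (u k))
    have h2 := sq_nonneg ‖u k - L (u k)‖
    have h3 := real_inner_comm (u k) (L (u k))
    simp only [hD, hu1]
    rw [inner_sub_left, real_inner_self_eq_norm_sq]
    linarith
  refine ⟨2 * D 0 / δ, c, hc0.le, hc1, ?_⟩
  have hmono : Monotone fun k => ‖u k‖ ^ 2 - 2 * D 0 / δ * c ^ k := by
    refine monotone_nat_of_le_succ fun k => ?_
    have h1 := hstep k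
    have h2 := hDgeo k
    have h3 : 2 * D 0 / δ * c ^ k - 2 * D 0 / δ * c ^ (k + 1) = 2 * (D 0 * c ^ k) := by
      rw [pow_succ, hc]; field_simp; ring
    linarith
  have hlim2 : Tendsto (fun k => ‖u k‖ ^ 2 - 2 * D 0 / δ * c ^ k) atTop (𝓝 0) := by
    have := (hlim.norm.pow 2).sub
      ((tendsto_pow_atTop_nhds_zero_of_lt_one hc0.le hc1).const_mul (2 * D 0 / δ))
    simpa using this
  intro k
  have := hmono.ge_of_tendsto hlim2 k
  linarith

end SpectralGap

section AlmostInvariant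

open scoped InnerProductSpace
open Filter Topology

universe u

variable {G : Type u} [Group G] [DecidableEq G] {S : Finset G}

/-- The averaging operator of a finite set in an isometric action. -/
noncomputable def averageAction {H : Type*} [NormedAddCommGroup H] [InnerProductSpace ℝ H]
    (ρ : G →* (H →ₗᵢ[ℝ] H)) (S : Finset G) : H →L[ℝ] H :=
  (S.card : ℝ)⁻¹ • ∑ s ∈ S, (ρ s).toContinuousLinearMap

section

variable {H : Type*} [NormedAddCommGroup H] [InnerProductSpace ℝ H] (ρ : G →* (H →ₗᵢ[ℝ] H))

omit [DecidableEq G] in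
lemma averageAction_apply (x : H) : averageAction ρ S x = (S.card : ℝ)⁻¹ • ∑ s ∈ S, ρ s x := by
  simp [averageAction]

omit [DecidableEq G] in
lemma norm_averageAction_le (x : H) : ‖averageAction ρ S x‖ ≤ ‖x‖ := by
  rcases S.eq_empty_or_nonempty with rfl | hS
  · simp [averageAction]
  have hc : (0 : ℝ) < S.card := by exact_mod_cast hS.card_pos
  rw [averageAction_apply, norm_smul, norm_inv, Real.norm_natCast, inv_mul_le_iff₀ hc]
  refine (norm_sum_le _ _).trans ?_
  simp

lemma inner_averageAction (hinv : S⁻¹ = S) (x y : H) :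
    ⟪averageAction ρ S x, y⟫_ℝ = ⟪x, averageAction ρ S y⟫_ℝ := by
  rw [averageAction_apply, averageAction_apply, inner_smul_left, inner_smul_right, sum_inner,
    inner_sum]
  congr 1
  refine Finset.sum_bij (fun s _ => s⁻¹) (fun s hs => ?_) (by simp) (fun s hs => ?_) fun s _ =>
    inner_isometricAction ρ s x y
  · rw [← hinv]; exact Finset.inv_mem_inv hs
  · exact ⟨s⁻¹, by rw [← hinv]; exact Finset.inv_mem_inv hs, inv_inv s⟩

omit [DecidableEq G] in
lemma isometricAction_eq_of_averageAction_eq (hS : S.Nonempty)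
    (hgen : Subgroup.closure (S : Set G) = ⊤) {x : H} (hx : averageAction ρ S x = x) (g : G) :
    ρ g x = x := by
  have hc : (S.card : ℝ) ≠ 0 := by exact_mod_cast hS.card_pos.ne'
  have h : ∀ s ∈ S, ρ s x = x := by
    refine eq_of_sum_eq_card_smul (P := fun s => ρ s) (fun s => (ρ s).norm_map) ?_
    nth_rw 2 [← hx]
    rw [averageAction_apply, smul_smul, mul_inv_cancel₀ hc, one_smul]
  have hg : g ∈ Subgroup.closure (S : Set G) := hgen ▸ Subgroup.mem_top g
  induction hg using Subgroup.closure_induction with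
  | mem s hs => exact h s hs
  | one => exact isometricAction_one_apply ρ x
  | mul g h _ _ hg hh => rw [isometricAction_mul_apply, hh, hg]
  | inv g _ hg =>
    apply (ρ g).injective
    rw [← isometricAction_mul_apply, mul_inv_cancel, isometricAction_one_apply, hg]

omit [DecidableEq G] in
lemma inner_sub_averageAction (hS : S.Nonempty) (x : H) :
    2 * S.card * ⟪x - averageAction ρ S x, x⟫_ℝ = ∑ s ∈ S, ‖ρ s x - x‖ ^ 2 := by
  have hc : (S.card : ℝ) ≠ 0 := by exact_mod_cast hS.card_pos.ne'
  simp_rw [norm_sub_sq_real, LinearIsometry.norm_map]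
  rw [inner_sub_left, averageAction_apply, inner_smul_left, sum_inner,
    real_inner_self_eq_norm_sq]
  simp only [Finset.sum_add_distrib, Finset.sum_sub_distrib, ← Finset.mul_sum, Finset.sum_const,
    nsmul_eq_mul, conj_trivial]
  field_simp
  ring

end

/-- In an infinite group of polynomial growth the regular representation has no spectral gap. -/
lemma exists_almost_invariant [Infinite G] (h1 : 1 ∈ S) (hinv : S⁻¹ = S)
    (hgen : Subgroup.closure (S : Set G) = ⊤) {C d : ℕ}
    (hC : ∀ n, (S ^ n).card ≤ C * (n + 1) ^ d) {ε : ℝ} (hε : 0 < ε) (hε1 : ε < 1) :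
    ∃ f, 0 < ⟪f - averageAction regularAction S f, f⟫_ℝ ∧
      ‖f - averageAction regularAction S f‖ ^ 2 ≤
        ε * ⟪f - averageAction regularAction S f, f⟫_ℝ := by
  have hS : S.Nonempty := ⟨1, h1⟩
  have hc : (S.card : ℝ) ≠ 0 := by exact_mod_cast hS.card_pos.ne'
  by_contra! hcon
  set M := averageAction (regularAction (G := G)) S with hM
  have hgap : ∀ f, ε * ⟪f - M f, f⟫_ℝ ≤ ‖f - M f‖ ^ 2 := by
    intro f
    by_cases hf : 0 < ⟪f - M f, f⟫_ℝ
    · exact (hcon f hf).le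
    · refine le_trans ?_ (sq_nonneg _)
      exact mul_nonpos_of_nonneg_of_nonpos hε.le (not_lt.1 hf)
  set L := (2 : ℝ)⁻¹ • (1 + M) with hL
  have hLapp : ∀ f, L f = (2 : ℝ)⁻¹ • (f + M f) := fun f => rfl
  have hsub : ∀ f, f - L f = (2 : ℝ)⁻¹ • (f - M f) := fun f => by
    rw [hLapp]; module
  obtain ⟨K, c, hc0, hc1, hdecay⟩ := exists_norm_sq_iterate_le L
    (fun x y => by
      rw [hLapp, hLapp, inner_smul_left, inner_smul_right, inner_add_left, inner_add_right,
        inner_averageAction _ hinv]; rfl)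
    (fun x => by
      rw [hLapp, inner_smul_left, inner_add_left, real_inner_self_eq_norm_mul_norm]
      have h1 := neg_le_of_abs_le (abs_real_inner_le_norm (M x) x)
      have h2 := mul_le_mul_of_nonneg_right (norm_averageAction_le (S := S) regularAction x)
        (norm_nonneg x)
      have : (0 : ℝ) ≤ ‖x‖ * ‖x‖ + ⟪M x, x⟫_ℝ := by linarith
      simp only [conj_trivial]
      positivity)
    (fun x => by
      rw [hLapp, norm_smul]
      have h1 := norm_add_le x (M x)
      have h2 := norm_averageAction_le (S := S) regularAction x
      norm_num
      linarith)
    (fun x hx => by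
      refine eq_zero_of_regularAction_eq
        (isometricAction_eq_of_averageAction_eq regularAction hS hgen ?_)
      have h2 : x - M x = (2 : ℝ) • (x - L x) := by rw [hsub]; module
      rw [hx, sub_self, smul_zero, sub_eq_zero] at h2
      exact h2.symm)
    (half_pos hε) (by linarith)
    (fun x => by
      rw [hsub, norm_smul, inner_smul_left, mul_pow]
      have := hgap x
      norm_num
      linarith) (lp.single 2 (1 : G) (1 : ℝ))
  set ind : Finset G → lp (fun _ : G => ℝ) 2 := fun T => ∑ x ∈ T, lp.single 2 x (1 : ℝ) with hind
  have hact : ∀ (g : G) T, regularAction g (ind T) = ind (g • T) := by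
    intro g T
    simp only [hind, map_sum, regularAction_single]
    rw [← Finset.image_smul, Finset.sum_image (by simp)]
    simp
  have hpair : ∀ k T, S ^ k ⊆ T → ⟪L^[k] (lp.single 2 (1 : G) (1 : ℝ)), ind T⟫_ℝ = 1 := by
    intro k
    induction k with
    | zero =>
      intro T hT
      have h1T : (1 : G) ∈ T := hT (by simp)
      simp only [Function.iterate_zero, id, hind, inner_sum]
      rw [Finset.sum_eq_single_of_mem 1 h1T]
      · rw [lp.inner_single_left]; simp
      · intro x _ hx
        rw [lp.inner_single_left, lp.single_apply_ne _ _ _ hx.symm]; simp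
    | succ k ih =>
      intro T hT
      rw [Function.iterate_succ_apply', hLapp, inner_smul_left, inner_add_left,
        ih T ((Finset.pow_subset_pow_right h1 k.le_succ).trans hT), hM, averageAction_apply,
        inner_smul_left, sum_inner]
      have : ∀ s ∈ S, ⟪regularAction s (L^[k] (lp.single 2 (1 : G) (1 : ℝ))), ind T⟫_ℝ = 1 := by
        intro s hs
        rw [inner_isometricAction, hact]
        exact ih _ (inv_smul_pow_subset hs hT)
      rw [Finset.sum_congr rfl this]
      simp [hc]
      norm_num
  have hnorm : ∀ T, ‖ind T‖ ^ 2 = T.card := by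
    intro T
    rw [← real_inner_self_eq_norm_sq]
    simp only [hind, sum_inner, inner_sum]
    rw [Finset.card_eq_sum_ones, Nat.cast_sum]
    refine Finset.sum_congr rfl fun x hx => ?_
    rw [Finset.sum_eq_single_of_mem x hx]
    · rw [lp.inner_single_left]; simp
    · intro y _ hy
      rw [lp.inner_single_left, lp.single_apply_ne _ _ _ hy]; simp
  have hlow : ∀ k : ℕ, 1 ≤ K * C * ((k + 1 : ℕ) ^ d * c ^ k) := by
    intro k
    have h1 := real_inner_mul_inner_self_le (L^[k] (lp.single 2 (1 : G) (1 : ℝ))) (ind (S ^ k))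
    rw [hpair k _ subset_rfl, real_inner_self_eq_norm_sq, real_inner_self_eq_norm_sq, hnorm,
      one_mul] at h1
    have h2 : ((S ^ k).card : ℝ) ≤ C * (k + 1 : ℕ) ^ d := by exact_mod_cast hC k
    calc (1 : ℝ) ≤ _ := h1
      _ ≤ (K * c ^ k) * (C * (k + 1 : ℕ) ^ d) :=
        mul_le_mul (hdecay k) h2 (by positivity) ((sq_nonneg _).trans (hdecay k))
      _ = _ := by ring
  have hlim : Tendsto (fun k : ℕ => K * C * (((k + 1 : ℕ) : ℝ) ^ d * c ^ k)) atTop (𝓝 0) := by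
    rcases hc0.eq_or_lt with rfl | hcpos
    · refine tendsto_const_nhds.congr' ?_
      filter_upwards [eventually_ge_atTop 1] with k hk
      simp [zero_pow (by lia : k ≠ 0)]
    have h2 := ((tendsto_pow_const_mul_const_pow_of_lt_one d hc0 hc1).comp
      (tendsto_add_atTop_nat 1)).const_mul (K * C * c⁻¹)
    rw [mul_zero] at h2
    refine h2.congr fun k => ?_
    simp only [Function.comp, pow_succ]
    field_simp
  exact absurd (ge_of_tendsto' hlim hlow) (by norm_num)

/-- An infinite group of polynomial growth has a non-zero harmonic cocycle. -/
theorem exists_harmonic_cocycle [Infinite G] (h1 : 1 ∈ S) (hinv : S⁻¹ = S)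
    (hgen : Subgroup.closure (S : Set G) = ⊤) {C d : ℕ}
    (hC : ∀ n, (S ^ n).card ≤ C * (n + 1) ^ d) :
    ∃ (K : Type u) (_ : NormedAddCommGroup K) (_ : InnerProductSpace ℝ K) (_ : CompleteSpace K)
      (π : G →* (K →ₗᵢ[ℝ] K)) (b : G → K), (∀ x y, b (x * y) = b x + π x (b y)) ∧
      ∑ s ∈ S, b s = 0 ∧ ∃ s ∈ S, b s ≠ 0 := by
  have hS : S.Nonempty := ⟨1, h1⟩
  have hc : (0 : ℝ) < S.card := by exact_mod_cast hS.card_pos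
  set ρ := regularAction (G := G)
  have hex : ∀ n : ℕ, ∃ f, ⟪f - averageAction ρ S f, f⟫_ℝ = 1 ∧
      ‖f - averageAction ρ S f‖ ^ 2 ≤ 1 / ((n : ℝ) + 2) := by
    intro n
    obtain ⟨f, hf0, hf⟩ := exists_almost_invariant h1 hinv hgen hC
      (ε := 1 / ((n : ℝ) + 2)) (by positivity) (by rw [div_lt_one (by positivity)]; linarith)
    set q := ⟪f - averageAction ρ S f, f⟫_ℝ with hq
    have hq2 : (√q)⁻¹ * (√q)⁻¹ * q = 1 := by
      rw [← mul_inv, Real.mul_self_sqrt hf0.le, inv_mul_cancel₀ hf0.ne']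
    have hsm : (√q)⁻¹ • f - averageAction ρ S ((√q)⁻¹ • f) =
        (√q)⁻¹ • (f - averageAction ρ S f) := by rw [map_smul, smul_sub]
    refine ⟨(√q)⁻¹ • f, ?_, ?_⟩
    · rw [hsm, inner_smul_left, inner_smul_right, ← hq, conj_trivial, ← mul_assoc, hq2]
    · rw [hsm, norm_smul, mul_pow, Real.norm_eq_abs, sq_abs]
      calc (√q)⁻¹ ^ 2 * ‖f - averageAction ρ S f‖ ^ 2
          ≤ (√q)⁻¹ ^ 2 * (1 / ((n : ℝ) + 2) * q) := by gcongr
        _ = 1 / ((n : ℝ) + 2) * ((√q)⁻¹ * (√q)⁻¹ * q) := by ring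
        _ = _ := by rw [hq2, mul_one]
  choose f hf1 hf2 using hex
  have hsum : ∀ n, ∑ s ∈ S, ‖ρ s (f n) - f n‖ ^ 2 = 2 * S.card := fun n => by
    rw [← inner_sub_averageAction ρ hS, hf1, mul_one]
  have hbdd : ∀ g, ∃ c, ∀ n, ‖ρ g (f n) - f n‖ ≤ c := by
    intro g
    have hg : g ∈ Subgroup.closure (S : Set G) := hgen ▸ Subgroup.mem_top g
    induction hg using Subgroup.closure_induction with
    | mem s hs =>
      refine ⟨√(2 * S.card), fun n => Real.le_sqrt_of_sq_le ?_⟩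
      rw [← hsum n]
      exact Finset.single_le_sum (f := fun s => ‖ρ s (f n) - f n‖ ^ 2)
        (fun _ _ => sq_nonneg _) hs
    | one => exact ⟨0, fun n => by simp [isometricAction_one_apply]⟩
    | mul x y _ _ hx hy =>
      obtain ⟨c, hc⟩ := hx
      obtain ⟨c', hc'⟩ := hy
      refine ⟨c' + c, fun n => ?_⟩
      have : ρ (x * y) (f n) - f n = ρ x (ρ y (f n) - f n) + (ρ x (f n) - f n) := by
        rw [isometricAction_mul_apply, map_sub]; abel
      rw [this]
      refine (norm_add_le _ _).trans (add_le_add ?_ (hc n))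
      rw [LinearIsometry.norm_map]; exact hc' n
    | inv x _ hx =>
      obtain ⟨c, hc⟩ := hx
      refine ⟨c, fun n => ?_⟩
      rw [← (ρ x).norm_map, map_sub, ← isometricAction_mul_apply, mul_inv_cancel,
        isometricAction_one_apply, norm_sub_rev]
      exact hc n
  set B : ℕ → (G →₀ ℝ) →ₗ[ℝ] lp (fun _ : G => ℝ) 2 :=
    fun n => Finsupp.linearCombination ℝ fun g => ρ g (f n) - f n with hB
  have hBs : ∀ n g, B n (Finsupp.single g 1) = ρ g (f n) - f n := fun n g => by simp [hB]
  set T : G → (G →₀ ℝ) →ₗ[ℝ] (G →₀ ℝ) := fun x =>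
    Finsupp.linearCombination ℝ fun g => Finsupp.single (x * g) 1 - Finsupp.single x 1 with hT
  have hTs : ∀ x g, T x (Finsupp.single g 1) = Finsupp.single (x * g) 1 - Finsupp.single x 1 :=
    fun x g => by simp [hT]
  obtain ⟨K, i1, i2, i3, π, j, hπ, hlim⟩ := exists_isometricAction_ultralimit ρ B
    (fun v => by
      induction v using Finsupp.induction_linear with
      | zero => exact ⟨0, by simp⟩
      | add v w hv hw =>
        obtain ⟨c, hc⟩ := hv
        obtain ⟨c', hc'⟩ := hw
        refine ⟨c + c', fun n => ?_⟩
        rw [map_add]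
        exact (norm_add_le _ _).trans (add_le_add (hc n) (hc' n))
      | single g r =>
        obtain ⟨c, hc⟩ := hbdd g
        refine ⟨‖r‖ * c, fun n => ?_⟩
        rw [← mul_one r, ← smul_eq_mul, ← Finsupp.smul_single, map_smul, norm_smul, hBs,
          smul_eq_mul, mul_one]
        exact mul_le_mul_of_nonneg_left (hc n) (norm_nonneg r))
    T
    (fun n x v => by
      induction v using Finsupp.induction_linear with
      | zero => simp
      | add v w hv hw => simp only [map_add, hv, hw]
      | single g r =>
        rw [← mul_one r, ← smul_eq_mul, ← Finsupp.smul_single]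
        simp only [map_smul, hTs, map_sub, hBs, isometricAction_mul_apply]
        congr 1
        abel)
  refine ⟨K, i1, i2, i3, π, fun g => j (Finsupp.single g 1), fun x y => ?_, ?_, ?_⟩
  · rw [hπ, hTs, map_sub]; abel
  · rw [← map_sum, ← norm_eq_zero]
    refine tendsto_nhds_unique (hlim _) ?_
    refine Tendsto.mono_left ?_ Nat.hyperfilter_le_atTop
    have hle : ∀ n, ‖B n (∑ s ∈ S, Finsupp.single s 1)‖ ≤ S.card * √(1 / ((n : ℝ) + 2)) := by
      intro n
      have : B n (∑ s ∈ S, Finsupp.single s 1) =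
          (-(S.card : ℝ)) • (f n - averageAction ρ S (f n)) := by
        rw [map_sum, Finset.sum_congr rfl fun s _ => hBs n s, Finset.sum_sub_distrib,
          averageAction_apply, smul_sub, smul_smul, neg_mul, mul_inv_cancel₀ hc.ne',
          Finset.sum_const, ← Nat.cast_smul_eq_nsmul ℝ]
        module
      rw [this, norm_smul, norm_neg, Real.norm_natCast]
      gcongr
      exact Real.le_sqrt_of_sq_le (hf2 n)
    refine squeeze_zero (fun n => norm_nonneg _) hle ?_
    have h2 : Tendsto (fun n : ℕ => 1 / ((n : ℝ) + 2)) atTop (𝓝 0) := by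
      have := (tendsto_one_div_add_atTop_nhds_zero_nat (𝕜 := ℝ)).comp (tendsto_add_atTop_nat 1)
      refine this.congr fun n => ?_
      simp only [Function.comp]
      push_cast
      ring
    simpa using h2.sqrt.const_mul (S.card : ℝ)
  · by_contra! hzero
    have h2 : Tendsto (fun n => ∑ s ∈ S, ‖B n (Finsupp.single s 1)‖ ^ 2) (hyperfilter ℕ)
        (𝓝 (∑ s ∈ S, ‖j (Finsupp.single s 1)‖ ^ 2)) :=
      tendsto_finsetSum _ fun s _ => (hlim _).pow 2
    simp_rw [hBs, hsum] at h2
    have h3 := tendsto_nhds_unique h2 tendsto_const_nhds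
    rw [Finset.sum_eq_zero fun s hs => by rw [hzero s hs]; simp] at h3
    linarith

end AlmostInvariant

section PolynomialGrowth

universe u v

variable {G : Type u} [Group G] {d : ℕ}

/-- A group has polynomial growth of degree at most `d` if the `n`-fold product sets of every finite
subset grow at most like a constant multiple of `n ^ d`. -/
def HasPolynomialGrowth (G : Type*) [Group G] (d : ℕ) : Prop :=
  ∀ F : Set G, F.Finite → ∃ C : ℕ, ∀ n, (F ^ n).ncard ≤ C * (n + 1) ^ d

lemma HasPolynomialGrowth.exists_card_le [DecidableEq G] (h : HasPolynomialGrowth G d)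
    (F : Finset G) : ∃ C : ℕ, ∀ n, (F ^ n).card ≤ C * (n + 1) ^ d := by
  obtain ⟨C, hC⟩ := h F F.finite_toSet
  refine ⟨C, fun n => ?_⟩
  rw [← Set.ncard_coe_finset, Finset.coe_pow]
  exact hC n

lemma Set.Finite.pow_set {F : Set G} (hF : F.Finite) (n : ℕ) : (F ^ n).Finite := by
  induction n with
  | zero => simp
  | succ n ih => rw [pow_succ]; exact ih.mul hF

lemma HasPolynomialGrowth.of_injective {G' : Type v} [Group G'] (h : HasPolynomialGrowth G d)
    (f : G' →* G) (hf : Function.Injective f) : HasPolynomialGrowth G' d := by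
  intro F hF
  obtain ⟨C, hC⟩ := h (f '' F) (hF.image f)
  refine ⟨C, fun n => ?_⟩
  rw [← Set.ncard_image_of_injective _ hf, Set.image_pow]
  exact hC n

lemma HasPolynomialGrowth.subgroup (h : HasPolynomialGrowth G d) (H : Subgroup G) :
    HasPolynomialGrowth H d :=
  h.of_injective H.subtype H.subtype_injective

lemma HasPolynomialGrowth.of_surjective {G' : Type v} [Group G'] (h : HasPolynomialGrowth G d)
    (f : G →* G') (hf : Function.Surjective f) : HasPolynomialGrowth G' d := by
  intro F hF
  obtain ⟨E, hE, rfl⟩ : ∃ E : Set G, E.Finite ∧ f '' E = F :=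
    ⟨Function.surjInv hf '' F, hF.image _, by
      rw [← Set.image_comp, Function.comp_surjInv, Set.image_id]⟩
  obtain ⟨C, hC⟩ := h E hE
  refine ⟨C, fun n => ?_⟩
  rw [← Set.image_pow]
  exact (Set.ncard_image_le (hE.pow_set n)).trans (hC n)

/-- Every finite set lies in a power of a symmetric generating set containing the identity. -/
lemma exists_subset_pow_of_closure_eq_top {S : Set G} (hinv : S⁻¹ = S) (h1 : 1 ∈ S)
    (hgen : Subgroup.closure S = ⊤) {F : Set G} (hF : F.Finite) : ∃ k : ℕ, F ⊆ S ^ k := by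
  have key : ∀ g : G, ∃ k : ℕ, g ∈ S ^ k := by
    intro g
    have hg : g ∈ Subgroup.closure S := by rw [hgen]; trivial
    induction hg using Subgroup.closure_induction with
    | mem x hx => exact ⟨1, by simpa using hx⟩
    | one => exact ⟨0, by simp⟩
    | mul x y _ _ hx hy =>
      obtain ⟨k, hk⟩ := hx
      obtain ⟨l, hl⟩ := hy
      exact ⟨k + l, by rw [pow_add]; exact Set.mul_mem_mul hk hl⟩
    | inv x _ hx =>
      obtain ⟨k, hk⟩ := hx
      refine ⟨k, ?_⟩
      rw [← hinv, inv_pow]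
      simpa using hk
  choose k hk using key
  refine ⟨hF.toFinset.sup k, fun g hg => ?_⟩
  exact Set.pow_subset_pow_right h1 (Finset.le_sup (hF.mem_toFinset.2 hg)) (hk g)

/-- Polynomial growth may be tested on one symmetric generating set. -/
lemma HasPolynomialGrowth.of_closure_eq_top {S : Set G} (hS : S.Finite) (hinv : S⁻¹ = S)
    (h1 : 1 ∈ S) (hgen : Subgroup.closure S = ⊤) {C : ℕ}
    (hC : ∀ n, (S ^ n).ncard ≤ C * (n + 1) ^ d) : HasPolynomialGrowth G d := by
  intro F hF
  obtain ⟨k, hk⟩ := exists_subset_pow_of_closure_eq_top hinv h1 hgen hF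
  refine ⟨C * (k + 1) ^ d, fun n => ?_⟩
  calc (F ^ n).ncard ≤ (S ^ (k * n)).ncard := by
        refine Set.ncard_le_ncard ?_ (hS.pow_set _)
        rw [pow_mul]
        exact Set.pow_subset_pow_left hk
    _ ≤ C * (k * n + 1) ^ d := hC _
    _ ≤ C * ((k + 1) * (n + 1)) ^ d := by gcongr; nlinarith
    _ = _ := by rw [mul_pow, mul_assoc]

/-- A finitely generated group has a finite symmetric generating set containing the identity. -/
lemma exists_finset_inv_eq_closure_eq_top [DecidableEq G] [hG : Group.FG G] :
    ∃ S : Finset G, 1 ∈ S ∧ S⁻¹ = S ∧ Subgroup.closure (S : Set G) = ⊤ := by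
  obtain ⟨S, hS⟩ := hG.out
  refine ⟨insert 1 (S ∪ S⁻¹), by simp, ?_, ?_⟩
  · ext x
    simp [or_comm]
  · rw [eq_top_iff, ← hS]
    exact Subgroup.closure_mono (by intro x hx; simp [Finset.mem_coe.1 hx])

lemma exists_mul_pow_lt_two_pow (C a d : ℕ) : ∃ m : ℕ, C * (a * m + 1) ^ d < 2 ^ m := by
  have h : Filter.Tendsto (fun m : ℕ => ((C : ℝ) * (a + 1) ^ d * 2 ^ d) * ((m : ℝ) ^ d / 2 ^ m))
      Filter.atTop (nhds 0) := by
    simpa using (tendsto_pow_const_div_const_pow_of_one_lt d (one_lt_two (α := ℝ))).const_mul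
      ((C : ℝ) * (a + 1) ^ d * 2 ^ d)
  obtain ⟨m, hm, hm1⟩ := ((h.eventually (gt_mem_nhds zero_lt_one)).and
    (Filter.eventually_ge_atTop 1)).exists
  refine ⟨m, ?_⟩
  have h2 : (0 : ℝ) < 2 ^ m := by positivity
  rw [← mul_div_assoc, div_lt_one h2] at hm
  have : C * (a * m + 1) ^ d ≤ C * (a + 1) ^ d * 2 ^ d * m ^ d := by
    rw [mul_assoc, mul_assoc, ← mul_pow, ← mul_pow]
    gcongr
    nlinarith
  refine lt_of_le_of_lt this ?_
  exact_mod_cast hm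

/-- Subexponentiality of polynomial growth. -/
lemma HasPolynomialGrowth.exists_ncard_pow_lt (h : HasPolynomialGrowth G d) {F : Set G}
    (hF : F.Finite) (a : ℕ) : ∃ m : ℕ, (F ^ (a * m)).ncard < 2 ^ m := by
  obtain ⟨C, hC⟩ := h F hF
  obtain ⟨m, hm⟩ := exists_mul_pow_lt_two_pow C a d
  exact ⟨m, (hC _).trans_lt hm⟩

/-- The product of the elements `t ^ j * e * t⁻¹ ^ j` over the positions `j` at which the Boolean
word is true. -/
def lampWord (t e : G) : List Bool → G
  | [] => 1
  | ε :: l => (bif ε then e else 1) * (t * lampWord t e l * t⁻¹)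

lemma lampWord_mul_pow_mem (t e : G) (l : List Bool) :
    lampWord t e l * t ^ l.length ∈ ({t, e * t} : Set G) ^ l.length := by
  induction l with
  | nil => simp [lampWord]
  | cons ε l ih =>
    have : lampWord t e (ε :: l) * t ^ (ε :: l).length =
        ((bif ε then e else 1) * t) * (lampWord t e l * t ^ l.length) := by
      simp [lampWord, pow_succ', mul_assoc]
    rw [this, List.length_cons, pow_succ']
    refine Set.mul_mem_mul ?_ ih
    cases ε <;> simp

/-- Under polynomial growth, two distinct Boolean words of equal length have the same product. -/
lemma HasPolynomialGrowth.exists_lampWord_eq (h : HasPolynomialGrowth G d) (t e : G) :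
    ∃ l l' : List Bool, l.length = l'.length ∧ l ≠ l' ∧ lampWord t e l = lampWord t e l' := by
  have hF : ({t, e * t} : Set G).Finite := by simp
  obtain ⟨m, hm⟩ := h.exists_ncard_pow_lt hF 1
  rw [one_mul] at hm
  have hfin := hF.pow_set m
  obtain ⟨x, -, y, -, hxy, hf⟩ := Finset.exists_ne_map_eq_of_card_lt_of_maps_to
    (s := (Finset.univ : Finset (List.Vector Bool m))) (t := hfin.toFinset)
    (f := fun l => lampWord t e l.1 * t ^ m)
    (by rwa [Finset.card_univ, card_vector, Fintype.card_bool, ← Set.ncard_eq_toFinset_card _ hfin])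
    (by
      intro l _
      have := lampWord_mul_pow_mem t e l.1
      rw [l.2] at this
      simpa using this)
  refine ⟨x.1, y.1, by rw [x.2, y.2], fun h => hxy (Subtype.ext h), mul_right_cancel hf⟩

end PolynomialGrowth

section CyclicQuotient

universe u

variable {G : Type u} [Group G] {d : ℕ}

lemma conj_lampWord_mem (t e : G) (m : ℕ) (l : List Bool) (i : ℕ) (h1 : 1 ≤ i)
    (hi : i + l.length ≤ m + 1) :
    t ^ i * lampWord t e l * (t ^ i)⁻¹ ∈
      Subgroup.closure ((fun j : ℕ => t ^ j * e * (t ^ j)⁻¹) '' Set.Icc 1 m) := by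
  induction l generalizing i with
  | nil => simp [lampWord, one_mem]
  | cons ε l ih =>
    rw [List.length_cons] at hi
    have h2 := ih (i + 1) (by omega) (by omega)
    have h3 : t ^ i * (bif ε then e else 1) * (t ^ i)⁻¹ ∈
        Subgroup.closure ((fun j : ℕ => t ^ j * e * (t ^ j)⁻¹) '' Set.Icc 1 m) := by
      cases ε
      · simp [one_mem]
      · exact Subgroup.subset_closure ⟨i, ⟨h1, by omega⟩, rfl⟩
    have : t ^ i * lampWord t e (ε :: l) * (t ^ i)⁻¹ =
        (t ^ i * (bif ε then e else 1) * (t ^ i)⁻¹) *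
          (t ^ (i + 1) * lampWord t e l * (t ^ (i + 1))⁻¹) := by
      simp only [lampWord, pow_succ]; group
    rw [this]
    exact mul_mem h3 h2

lemma exists_mem_closure_of_lampWord_eq {t e : G} {l l' : List Bool}
    (hlen : l.length = l'.length) (hne : l ≠ l') (h : lampWord t e l = lampWord t e l') :
    ∃ m : ℕ, e ∈ Subgroup.closure ((fun j : ℕ => t ^ j * e * (t ^ j)⁻¹) '' Set.Icc 1 m) := by
  induction l generalizing l' with
  | nil =>
    cases l' with
    | nil => exact absurd rfl hne
    | cons => simp at hlen
  | cons ε l ih =>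
    cases l' with
    | nil => simp at hlen
    | cons ε' l' =>
      have hlen' : l.length = l'.length := by simpa using hlen
      by_cases hε : ε = ε'
      · subst hε
        refine ih hlen' (fun h => hne (by rw [h])) ?_
        simpa [lampWord] using h
      · refine ⟨l.length, ?_⟩
        have h1 := conj_lampWord_mem t e l.length l 1 le_rfl (by omega)
        have h2 := conj_lampWord_mem t e l.length l' 1 le_rfl (by omega)
        simp only [pow_one] at h1 h2
        simp only [lampWord] at h
        cases ε <;> cases ε' <;> simp only [cond_true, cond_false, one_mul] at h hε
        · exact absurd trivial hε
        · have := mul_mem h1 (inv_mem h2)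
          rwa [← eq_mul_inv_iff_mul_eq.2 h.symm] at this
        · have := mul_mem h2 (inv_mem h1)
          rwa [← eq_mul_inv_iff_mul_eq.2 h] at this
        · exact absurd trivial hε

lemma conj_zpow_mem {A : Subgroup G} {t : G} (h : ∀ a ∈ A, t * a * t⁻¹ ∈ A)
    (h' : ∀ a ∈ A, t⁻¹ * a * t ∈ A) (k : ℤ) : ∀ a ∈ A, t ^ k * a * (t ^ k)⁻¹ ∈ A := by
  induction k using Int.induction_on with
  | zero => simp
  | succ n ih =>
    intro a ha
    have := h _ (ih a ha)
    rw [add_comm, zpow_add]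
    simpa [mul_assoc] using this
  | pred n ih =>
    intro a ha
    have := h' _ (ih a ha)
    rw [sub_eq_add_neg, add_comm, zpow_add]
    simpa [mul_assoc] using this

/-- Under polynomial growth, the conjugates of one element by the powers of another one generate a
finitely generated subgroup. -/
lemma HasPolynomialGrowth.exists_fg_conj_mem (h : HasPolynomialGrowth G d) (t e : G) :
    ∃ A : Subgroup G, A.FG ∧ e ∈ A ∧ A ≤ Subgroup.normalClosure {e} ∧
      (∀ a ∈ A, t * a * t⁻¹ ∈ A) ∧ ∀ a ∈ A, t⁻¹ * a * t ∈ A := by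
  have key : ∀ t : G, ∃ m : ℕ, e ∈ Subgroup.closure
      ((fun j : ℕ => t ^ j * e * (t ^ j)⁻¹) '' Set.Icc 1 m) := by
    intro t
    obtain ⟨l, l', h1, h2, h3⟩ := h.exists_lampWord_eq t e
    exact exists_mem_closure_of_lampWord_eq h1 h2 h3
  obtain ⟨m, hm⟩ := key t
  obtain ⟨n, hn⟩ := key t⁻¹
  set c : ℤ → G := fun j => t ^ j * e * (t ^ j)⁻¹ with hc
  set M : ℤ := max m n with hM
  set A := Subgroup.closure (c '' Set.Icc (-M) M) with hA
  have hmem : ∀ j : ℤ, -M ≤ j → j ≤ M → c j ∈ A := fun j h1 h2 =>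
    Subgroup.subset_closure ⟨j, ⟨h1, h2⟩, rfl⟩
  have hM0 : 0 ≤ M := by omega
  have hconj : ∀ (k : ℤ) (F : Set G), (∀ x ∈ F, t ^ k * x * (t ^ k)⁻¹ ∈ A) →
      ∀ a ∈ Subgroup.closure F, t ^ k * a * (t ^ k)⁻¹ ∈ A := by
    intro k F hF a ha
    have : Subgroup.closure F ≤ A.comap (MulAut.conj (t ^ k)).toMonoidHom := by
      rw [Subgroup.closure_le]
      intro x hx
      exact hF x hx
    exact this ha
  have hcc : ∀ k j : ℤ, t ^ k * c j * (t ^ k)⁻¹ = c (k + j) := by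
    intro k j
    simp only [hc, zpow_add]; group
  refine ⟨A, ⟨((Set.finite_Icc (-M) M).image c).toFinset, by simp [hA]⟩, ?_, ?_, ?_, ?_⟩
  · simpa [hc] using hmem 0 (by omega) hM0
  · rw [hA, Subgroup.closure_le]
    rintro _ ⟨j, -, rfl⟩
    exact Subgroup.normalClosure_normal.conj_mem e
      (Subgroup.subset_normalClosure (Set.mem_singleton e)) (t ^ j)
  · have := hconj 1 (c '' Set.Icc (-M) M) ?_
    · simpa using this
    rintro _ ⟨j, ⟨hj1, hj2⟩, rfl⟩
    rw [hcc]
    rcases hj2.lt_or_eq with hj | rfl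
    · exact hmem _ (by omega) (by omega)
    · have := hconj (1 + M) _ ?_ e hn
      · exact this
      rintro _ ⟨i, ⟨hi1, hi2⟩, rfl⟩
      have : (fun j : ℕ => t⁻¹ ^ j * e * (t⁻¹ ^ j)⁻¹) i = c (-i) := by
        simp [hc]
      rw [this, hcc]
      exact hmem _ (by omega) (by omega)
  · have := hconj (-1) (c '' Set.Icc (-M) M) ?_
    · simpa using this
    rintro _ ⟨j, ⟨hj1, hj2⟩, rfl⟩
    rw [hcc]
    rcases hj1.lt_or_eq with hj | rfl
    · exact hmem _ (by omega) (by omega)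
    · have := hconj (-1 + -M) _ ?_ e hm
      · exact this
      rintro _ ⟨i, ⟨hi1, hi2⟩, rfl⟩
      have : (fun j : ℕ => t ^ j * e * (t ^ j)⁻¹) i = c i := by
        simp [hc]
      rw [this, hcc]
      exact hmem _ (by omega) (by omega)

/-- Under polynomial growth, the kernel of a homomorphism onto the integers is finitely
generated. -/
lemma HasPolynomialGrowth.fg_ker [Group.FG G] (h : HasPolynomialGrowth G d)
    (φ : G →* Multiplicative ℤ) {t : G} (ht : φ t = Multiplicative.ofAdd 1) : φ.ker.FG := by
  obtain ⟨S, hS⟩ := (inferInstance : Group.FG G).out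
  have hφ : ∀ k : ℤ, φ (t ^ k) = Multiplicative.ofAdd k := by
    intro k; rw [map_zpow, ht, ← ofAdd_zsmul]; simp
  choose A hfg hmem hle hconj hconj' using h.exists_fg_conj_mem t
  set e : G → G := fun s => s * (t ^ (φ s).toAdd)⁻¹ with he
  have hker : ∀ s, e s ∈ φ.ker := by
    intro s
    rw [MonoidHom.mem_ker, he, map_mul, map_inv, hφ]
    simp
  set B : Subgroup G := S.sup fun s => A (e s) with hB
  have hBfg : B.FG := Subgroup.FG.finset_sup S _ fun s _ => hfg _
  have hBle : B ≤ φ.ker := Finset.sup_le fun s _ =>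
    (hle _).trans (Subgroup.normalClosure_le_normal (by simpa using hker s))
  have hBconj : ∀ k : ℤ, (∀ s, ∀ a ∈ A (e s), t ^ k * a * (t ^ k)⁻¹ ∈ A (e s)) →
      ∀ a ∈ B, t ^ k * a * (t ^ k)⁻¹ ∈ B := by
    intro k hk a ha
    have : B ≤ B.comap (MulAut.conj (t ^ k)).toMonoidHom := by
      refine Finset.sup_le fun s hs a ha => ?_
      have h1 : A (e s) ≤ B := Finset.le_sup (f := fun s => A (e s)) hs
      exact h1 (hk s a ha)
    exact this ha
  have hBz : ∀ k : ℤ, ∀ a ∈ B, t ^ k * a * (t ^ k)⁻¹ ∈ B := fun k =>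
    hBconj k fun s => conj_zpow_mem (hconj _) (hconj' _) k
  have key : ∀ g : G, ∃ k : ℤ, g * t ^ k ∈ B := by
    intro g
    have hg : g ∈ Subgroup.closure (S : Set G) := by rw [hS]; trivial
    induction hg using Subgroup.closure_induction with
    | mem x hx =>
      have h1 : A (e x) ≤ B := Finset.le_sup (f := fun s => A (e s)) hx
      refine ⟨-(φ x).toAdd, h1 ?_⟩
      rw [zpow_neg]
      exact hmem (e x)
    | one => exact ⟨0, by simp [one_mem]⟩
    | mul x y _ _ hx hy =>
      obtain ⟨k, hk⟩ := hx
      obtain ⟨l, hl⟩ := hy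
      refine ⟨l + k, ?_⟩
      have := mul_mem hk (hBz (-k) _ hl)
      rw [zpow_add]
      simpa [mul_assoc] using this
    | inv x _ hx =>
      obtain ⟨k, hk⟩ := hx
      refine ⟨-k, ?_⟩
      have := hBz k _ (inv_mem hk)
      rw [zpow_neg]
      simpa [mul_assoc] using this
  convert! hBfg using 1
  refine le_antisymm (fun g hg => ?_) hBle
  obtain ⟨k, hk⟩ := key g
  have h1 := hBle hk
  rw [MonoidHom.mem_ker, map_mul, hg, one_mul, hφ] at h1
  have : k = 0 := by simpa using h1
  simpa [this] using hk

/-- The kernel of a homomorphism onto the integers has growth of smaller degree. -/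
lemma HasPolynomialGrowth.exists_ker (h : HasPolynomialGrowth G d)
    (φ : G →* Multiplicative ℤ) {t : G} (ht : φ t = Multiplicative.ofAdd 1) :
    ∃ c, d = c + 1 ∧ HasPolynomialGrowth φ.ker c := by
  have hφ : ∀ k : ℕ, φ (t ^ k) = Multiplicative.ofAdd (k : ℤ) := by
    intro k; rw [map_pow, ht, ← ofAdd_nsmul]; simp
  have key : ∀ F : Set φ.ker, F.Finite → ∃ C : ℕ, ∀ n, (n + 1) * (F ^ n).ncard ≤
      C * (n + 1) ^ d := by
    intro F hF
    set E : Set G := insert 1 (insert t (Subtype.val '' F)) with hE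
    have hEf : E.Finite := ((hF.image _).insert t).insert 1
    obtain ⟨C, hC⟩ := h E hEf
    refine ⟨C * 2 ^ d, fun n => ?_⟩
    have hmaps : ((fun p : φ.ker × ℕ => (p.1 : G) * t ^ p.2) '' ((F ^ n) ×ˢ Set.Iio (n + 1))) ⊆
        E ^ (n + n) := by
      rintro _ ⟨⟨g, j⟩, ⟨hg, hj⟩, rfl⟩
      rw [pow_add]
      refine Set.mul_mem_mul ?_ ?_
      · have h1 : (g : G) ∈ (Subtype.val '' F) ^ n := by
          have := Set.mem_image_of_mem φ.ker.subtype hg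
          rwa [Set.image_pow] at this
        exact Set.pow_subset_pow_left
          ((Set.subset_insert _ _).trans (Set.subset_insert _ _)) h1
      · refine Set.pow_subset_pow_right (by simp [hE]) (Nat.lt_succ_iff.1 hj) ?_
        exact Set.pow_mem_pow (by simp [hE])
    have hinj : Set.InjOn (fun p : φ.ker × ℕ => (p.1 : G) * t ^ p.2)
        ((F ^ n) ×ˢ Set.Iio (n + 1)) := by
      rintro ⟨g, j⟩ - ⟨g', j'⟩ - hgg
      have h1 := congrArg φ hgg
      simp only [map_mul, hφ] at h1
      rw [show φ g = 1 from g.2, show φ g' = 1 from g'.2] at h1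
      have h2 : j = j' := by simpa using h1
      subst h2
      simpa using hgg
    have h1 := Set.ncard_le_ncard hmaps (hEf.pow_set _)
    rw [hinj.ncard_image, Set.ncard_prod] at h1
    have h2 : (Set.Iio (n + 1)).ncard = n + 1 := by
      rw [← Finset.coe_Iio, Set.ncard_coe_finset]; simp
    rw [h2, mul_comm] at h1
    refine h1.trans ((hC _).trans ?_)
    rw [mul_assoc, ← mul_pow]
    gcongr
    omega
  rcases d with - | c
  · obtain ⟨C, hC⟩ := key {1} (Set.finite_singleton 1)
    have := hC C
    simp only [Set.singleton_pow, one_pow, Set.ncard_singleton, pow_zero] at this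
    omega
  · refine ⟨c, rfl, fun F hF => ?_⟩
    obtain ⟨C, hC⟩ := key F hF
    refine ⟨C, fun n => ?_⟩
    have := hC n
    rw [pow_succ, ← mul_assoc, mul_comm (n + 1)] at this
    exact Nat.le_of_mul_le_mul_right this (Nat.succ_pos n)

/-- A group all of whose subgroups in the kernel of a homomorphism to the integers are finitely
generated has only finitely generated subgroups. -/
lemma fg_of_forall_fg_ker (φ : G →* Multiplicative ℤ) (h : ∀ L : Subgroup G, L ≤ φ.ker → L.FG)
    (L : Subgroup G) : L.FG := by
  obtain ⟨a, ha⟩ := IsCyclic.exists_generator (α := L.map φ)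
  obtain ⟨t, htL, ht⟩ : ∃ t ∈ L, φ t = a := a.2
  have : L = (L ⊓ φ.ker) ⊔ Subgroup.zpowers t := by
    refine le_antisymm (fun g hg => ?_) (sup_le inf_le_left (by simpa using htL))
    obtain ⟨k, hk⟩ := ha ⟨φ g, Subgroup.mem_map_of_mem φ hg⟩
    have hk' : φ t ^ k = φ g := by rw [ht]; simpa using congrArg Subtype.val hk
    have h1 : g * (t ^ k)⁻¹ ∈ L ⊓ φ.ker := by
      refine Subgroup.mem_inf.2 ⟨mul_mem hg (inv_mem (zpow_mem htL k)), ?_⟩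
      rw [MonoidHom.mem_ker, map_mul, map_inv, map_zpow, hk', mul_inv_cancel]
    have h2 := Subgroup.mul_mem_sup h1 (Subgroup.zpow_mem_zpowers t k)
    simpa using h2
  rw [this]
  exact (h _ inf_le_right).sup ⟨{t}, by simp [Subgroup.zpowers_eq_closure]⟩

end CyclicQuotient

section Unipotent

open Polynomial

variable {A : Type*} [AddCommGroup A]

/-- The sum of the elements `α ^ j e` over the positions `j` at which the Boolean word is true. -/
def lampSum (α : Module.End ℤ A) (e : A) : List Bool → A
  | [] => 0
  | ε :: l => (bif ε then e else 0) + α (lampSum α e l)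

/-- The coefficientwise evaluation of a Boolean word at a complex number. -/
def lampValue (μ : ℂ) : List Bool → ℂ
  | [] => 0
  | ε :: l => (bif ε then 1 else 0) + μ * lampValue μ l

lemma one_le_norm_lampValue_sub {μ : ℂ} (hμ : 2 ≤ ‖μ‖) {l l' : List Bool}
    (hlen : l.length = l'.length) (hne : l ≠ l') : 1 ≤ ‖lampValue μ l - lampValue μ l'‖ := by
  induction l generalizing l' with
  | nil =>
    cases l' with
    | nil => exact absurd rfl hne
    | cons => simp at hlen
  | cons ε l ih =>
    cases l' with
    | nil => simp at hlen
    | cons ε' l' =>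
      by_cases hl : l = l'
      · subst hl
        have hε : ε ≠ ε' := fun h => hne (by rw [h])
        cases ε <;> cases ε' <;> simp_all [lampValue]
      · have h1 := ih (by simpa using hlen) hl
        set x := lampValue μ l - lampValue μ l' with hx
        have h2 : lampValue μ (ε :: l) - lampValue μ (ε' :: l') =
            μ * x - ((bif ε' then (1 : ℂ) else 0) - (bif ε then 1 else 0)) := by
          simp only [lampValue, hx]; ring
        have h3 : ‖((bif ε' then (1 : ℂ) else 0) - (bif ε then 1 else 0))‖ ≤ 1 := by
          cases ε <;> cases ε' <;> simp
        have h4 := norm_sub_norm_le (μ * x)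
          ((bif ε' then (1 : ℂ) else 0) - (bif ε then 1 else 0))
        rw [h2]
        rw [norm_mul] at h4
        nlinarith

lemma map_lampSum (α : Module.End ℤ A) (e : A) (f : A →ₗ[ℤ] ℂ) (μ : ℂ)
    (hf : ∀ x, f (α x) = μ * f x) (l : List Bool) :
    f (lampSum α e l) = lampValue μ l * f e := by
  induction l with
  | nil => simp [lampSum, lampValue]
  | cons ε l ih =>
    simp only [lampSum, lampValue, map_add, hf, ih, add_mul, mul_assoc]
    cases ε <;> simp

/-- Coincidences of lamp sums bound the eigenvalues of the dual of an endomorphism. -/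
lemma norm_le_one_of_lampSum_eq (α : Module.End ℤ A)
    (h : ∀ j : ℕ, ∀ e : A, ∃ l l' : List Bool, l.length = l'.length ∧ l ≠ l' ∧
      lampSum (α ^ j) e l = lampSum (α ^ j) e l')
    (f : A →ₗ[ℤ] ℂ) (hf0 : f ≠ 0) (μ : ℂ) (hf : ∀ x, f (α x) = μ * f x) : ‖μ‖ ≤ 1 := by
  by_contra! hμ
  obtain ⟨e, he⟩ : ∃ e, f e ≠ 0 := by
    by_contra! h0
    exact hf0 (LinearMap.ext h0)
  obtain ⟨j, hj⟩ := pow_unbounded_of_one_lt 2 hμ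
  have hfj : ∀ x, f ((α ^ j) x) = μ ^ j * f x := by
    clear hj
    induction j with
    | zero => simp
    | succ j ih =>
      intro x
      rw [pow_succ', Module.End.mul_apply, hf, ih, pow_succ', mul_assoc]
  obtain ⟨l, l', hlen, hne, hll⟩ := h j e
  have h1 := one_le_norm_lampValue_sub (μ := μ ^ j) (by rw [norm_pow]; exact hj.le) hlen hne
  have h2 := congrArg f hll
  rw [map_lampSum _ _ _ _ hfj, map_lampSum _ _ _ _ hfj] at h2
  rw [mul_right_cancel₀ he h2, sub_self, norm_zero] at h1
  exact absurd h1 (by norm_num)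

lemma isIntegral_eigenvalue [Module.Finite ℤ A] {E : Type*} [Field E] (α : Module.End ℤ A)
    (f : A →ₗ[ℤ] E) (hf0 : f ≠ 0) (μ : E) (hf : ∀ x, f (α x) = μ * f x) : IsIntegral ℤ μ := by
  obtain ⟨p, hp, hpα⟩ := Algebra.IsIntegral.isIntegral (R := ℤ) α
  refine ⟨p, hp, ?_⟩
  obtain ⟨e, he⟩ : ∃ e, f e ≠ 0 := by
    by_contra! h0
    exact hf0 (LinearMap.ext h0)
  have key : ∀ q : ℤ[X], ∀ x, f (aeval α q x) = aeval μ q * f x := by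
    intro q
    induction q using Polynomial.induction_on' with
    | add p q hp hq => intro x; simp [hp, hq, add_mul]
    | monomial n a =>
      have hn : ∀ x, f ((α ^ n) x) = μ ^ n * f x := by
        induction n with
        | zero => simp
        | succ j ih =>
          intro x
          rw [pow_succ', Module.End.mul_apply, hf, ih, pow_succ', mul_assoc]
      intro x
      simp [aeval_monomial, hn, mul_assoc]
  have h1 := key p e
  rw [show aeval α p = 0 from hpα] at h1
  have h2 : aeval μ p * f e = 0 := by rw [← h1]; simp
  exact (mul_eq_zero.1 h2).resolve_right he

/-- Coincidences of lamp sums force the eigenvalues of the dual to be roots of unity. -/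
lemma exists_pow_eq_one_of_lampSum_eq [Module.Finite ℤ A] (α : Module.End ℤ A)
    (hα : Function.Surjective α)
    (h : ∀ j : ℕ, ∀ e : A, ∃ l l' : List Bool, l.length = l'.length ∧ l ≠ l' ∧
      lampSum (α ^ j) e l = lampSum (α ^ j) e l')
    (f : A →ₗ[ℤ] AlgebraicClosure ℚ) (hf0 : f ≠ 0) (μ : AlgebraicClosure ℚ)
    (hf : ∀ x, f (α x) = μ * f x) : ∃ k : ℕ, 0 < k ∧ μ ^ k = 1 := by
  have hμ0 : μ ≠ 0 := by
    rintro rfl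
    refine hf0 (LinearMap.ext fun x => ?_)
    obtain ⟨y, rfl⟩ := hα x
    simp [hf]
  have hintegral := isIntegral_eigenvalue α f hf0 μ hf
  have halg : IsIntegral ℚ μ := hintegral.tower_top
  let K := IntermediateField.adjoin ℚ {μ}
  have : FiniteDimensional ℚ K := IntermediateField.adjoin.finiteDimensional halg
  have : NumberField K := { }
  let y : K := ⟨μ, IntermediateField.mem_adjoin_simple_self ℚ μ⟩
  have hy0 : y ≠ 0 := fun h0 => hμ0 (congrArg Subtype.val h0)
  have hyint : IsIntegral ℤ y := by
    refine (isIntegral_algebraMap_iff (algebraMap K (AlgebraicClosure ℚ)).injective).1 ?_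
    exact hintegral
  obtain ⟨k, hk, hyk⟩ := NumberField.Embeddings.pow_eq_one_of_norm_le_one K ℂ hy0 hyint (by
    intro φ
    let _ : Algebra K ℂ := φ.toAlgebra
    have : Algebra.IsAlgebraic ℚ (AlgebraicClosure ℚ) := AlgebraicClosure.isAlgebraic ℚ
    have : Algebra.IsAlgebraic K (AlgebraicClosure ℚ) :=
      Algebra.IsAlgebraic.tower_top (K := ℚ) K
    let ψ : AlgebraicClosure ℚ →ₐ[K] ℂ := IsAlgClosed.lift
    have hψ : φ y = ψ μ := (ψ.commutes y).symm
    rw [hψ]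
    refine norm_le_one_of_lampSum_eq α h ((ψ : AlgebraicClosure ℚ →+ ℂ).toIntLinearMap ∘ₗ f)
      ?_ _ fun x => ?_
    · intro h0
      refine hf0 (LinearMap.ext fun x => ψ.injective ?_)
      have := LinearMap.congr_fun h0 x
      simpa using this
    · simp [hf])
  exact ⟨k, hk, by simpa [y] using congrArg Subtype.val hyk⟩

lemma exists_pow_sub_one_pow_eq_zero {E V : Type*} [Field E] [IsAlgClosed E] [AddCommGroup V]
    [Module E V] [FiniteDimensional E V] (T : Module.End E V)
    (hT : ∀ μ, T.HasEigenvalue μ → ∃ k : ℕ, 0 < k ∧ μ ^ k = 1) :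
    ∃ k : ℕ, 0 < k ∧ ∃ c : ℕ, (T ^ k - 1) ^ c = 0 := by
  classical
  have hT' : ∀ μ, ∃ k : ℕ, 0 < k ∧ (T.HasEigenvalue μ → μ ^ k = 1) := by
    intro μ
    by_cases hμ : T.HasEigenvalue μ
    · obtain ⟨k, hk, h⟩ := hT μ hμ
      exact ⟨k, hk, fun _ => h⟩
    · exact ⟨1, one_pos, fun h => absurd h hμ⟩
  choose k hk hkμ using hT'
  have hintegral : IsIntegral E T := Algebra.IsIntegral.isIntegral T
  set p := minpoly E T with hp
  set n := ∏ μ ∈ p.roots.toFinset, k μ with hn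
  refine ⟨n, Finset.prod_pos fun μ _ => hk μ, p.roots.card, ?_⟩
  have hdvd : p ∣ (X ^ n - 1) ^ p.roots.card := by
    have h1 := (IsAlgClosed.splits p).eq_prod_roots_of_monic (minpoly.monic hintegral)
    have h2 : (p.roots.map fun a => X - C a).prod ∣
        (p.roots.map fun _ => (X ^ n - 1 : E[X])).prod := by
      refine Multiset.prod_dvd_prod_of_dvd _ _ fun μ hμ => ?_
      rw [Polynomial.dvd_iff_isRoot]
      have h3 : μ ^ k μ = 1 := hkμ μ (Module.End.hasEigenvalue_of_isRoot
        (Polynomial.isRoot_of_mem_roots hμ))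
      have h4 : k μ ∣ n := Finset.dvd_prod_of_mem k (Multiset.mem_toFinset.2 hμ)
      obtain ⟨r, hr⟩ := h4
      simp [hr, pow_mul, h3]
    rw [← h1] at h2
    simpa using h2
  have := aeval_eq_zero_of_dvd_aeval_eq_zero hdvd (minpoly.aeval E T)
  simpa using this

lemma finite_dual_of_finite (A : Type*) [AddCommGroup A] [Module.Finite ℤ A] (E : Type*) [Field E] :
    FiniteDimensional E (A →ₗ[ℤ] E) := by
  obtain ⟨s, hs⟩ := Module.Finite.fg_top (R := ℤ) (M := A)
  let ev : (A →ₗ[ℤ] E) →ₗ[E] (s → E) :=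
    { toFun := fun f x => f x
      map_add' := fun _ _ => rfl
      map_smul' := fun _ _ => rfl }
  refine FiniteDimensional.of_injective ev fun f g hfg => ?_
  refine LinearMap.ext_on hs fun x hx => ?_
  exact congrFun hfg ⟨x, hx⟩

lemma exists_dual_ne_zero [Module.Finite ℤ A] {E : Type*} [Field E] [CharZero E] (x : A)
    (hx : x ∉ Submodule.torsion ℤ A) : ∃ f : A →ₗ[ℤ] E, f x ≠ 0 := by
  let b := Module.Free.chooseBasis ℤ (A ⧸ Submodule.torsion ℤ A)
  have h1 : (Submodule.torsion ℤ A).mkQ x ≠ 0 := by simpa using hx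
  obtain ⟨i, hi⟩ : ∃ i, b.repr ((Submodule.torsion ℤ A).mkQ x) i ≠ 0 := by
    by_contra! h0
    exact h1 (b.repr.map_eq_zero_iff.1 (Finsupp.ext h0))
  refine ⟨(Int.castAddHom E).toIntLinearMap ∘ₗ b.coord i ∘ₗ (Submodule.torsion ℤ A).mkQ, ?_⟩
  simpa using hi

/-- An automorphism of a finitely generated abelian group with coincidences of lamp sums is virtually
unipotent. -/
lemma exists_pow_sub_one_pow_eq_zero_of_lampSum_eq [Module.Finite ℤ A] (α : Module.End ℤ A)
    (hα : Function.Bijective α)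
    (h : ∀ j : ℕ, ∀ e : A, ∃ l l' : List Bool, l.length = l'.length ∧ l ≠ l' ∧
      lampSum (α ^ j) e l = lampSum (α ^ j) e l') :
    ∃ k : ℕ, 0 < k ∧ ∃ c : ℕ, (α ^ k - 1) ^ c = 0 := by
  have := finite_dual_of_finite A (AlgebraicClosure ℚ)
  let T : Module.End (AlgebraicClosure ℚ) (A →ₗ[ℤ] AlgebraicClosure ℚ) :=
    { toFun := fun f => f ∘ₗ α
      map_add' := fun _ _ => rfl
      map_smul' := fun _ _ => rfl }
  obtain ⟨k, hk, c, hc⟩ := exists_pow_sub_one_pow_eq_zero T (by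
    intro μ hμ
    obtain ⟨f, hf⟩ := hμ.exists_hasEigenvector
    exact exists_pow_eq_one_of_lampSum_eq α hα.2 h f hf.2 μ fun x =>
      LinearMap.congr_fun hf.apply_eq_smul x)
  have hTk : ∀ n : ℕ, ∀ f, (T ^ n) f = f ∘ₗ (α ^ n) := by
    intro n
    induction n with
    | zero => intro f; rfl
    | succ n ih => intro f; rw [pow_succ', Module.End.mul_apply, ih, pow_succ]; rfl
  have hTkc : ∀ n : ℕ, ∀ f, ((T ^ k - 1) ^ n) f = f ∘ₗ ((α ^ k - 1) ^ n) := by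
    intro n
    induction n with
    | zero => intro f; rfl
    | succ n ih =>
      intro f
      rw [pow_succ', Module.End.mul_apply, ih, pow_succ]
      ext x
      simp [hTk]
  have htors : ∀ x, ((α ^ k - 1) ^ c) x ∈ Submodule.torsion ℤ A := by
    intro x
    by_contra hx
    obtain ⟨f, hf⟩ := exists_dual_ne_zero (E := AlgebraicClosure ℚ) _ hx
    refine hf ?_
    have := hTkc c f
    rw [hc] at this
    exact (LinearMap.congr_fun this x).symm
  have hfin : Finite (Submodule.torsion ℤ A) := by
    have : Module.Finite ℤ (Submodule.torsion ℤ A) :=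
      Module.Finite.of_fg (IsNoetherian.noetherian _)
    exact Module.finite_of_fg_torsion _ (Submodule.torsion_isTorsion)
  have hinj : Function.Injective (α ^ k) := by
    rw [Module.End.coe_pow]; exact hα.1.iterate k
  have hpres : ∀ x ∈ Submodule.torsion ℤ A, (α ^ k) x ∈ Submodule.torsion ℤ A := by
    rintro x ⟨a, ha⟩
    refine ⟨a, ?_⟩
    have := congrArg (α ^ k) ha
    rw [map_zero] at this
    rw [← this]
    exact ((α ^ k).map_smul_of_tower a x).symm
  let σ : Equiv.Perm (Submodule.torsion ℤ A) := Equiv.ofBijective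
    (fun x => ⟨(α ^ k) x, hpres x x.2⟩)
    (Finite.injective_iff_bijective.1 fun x y hxy =>
      Subtype.ext (hinj (congrArg Subtype.val hxy)))
  obtain ⟨n, hn, hσ⟩ := isOfFinOrder_iff_pow_eq_one.1 (isOfFinOrder_of_finite σ)
  have hαn : ∀ x ∈ Submodule.torsion ℤ A, (α ^ (k * n)) x = x := by
    intro x hx
    have h1 : ∀ m : ℕ, ((σ ^ m) ⟨x, hx⟩ : A) = ((α ^ k) ^ m) x := by
      intro m
      induction m with
      | zero => rfl
      | succ m ih => rw [pow_succ', pow_succ', Module.End.mul_apply, ← ih]; rfl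
    have := h1 n
    rw [hσ] at this
    rw [pow_mul, ← this]; rfl
  refine ⟨k * n, Nat.mul_pos hk hn, c + 1, ?_⟩
  have hdvd : (X ^ k - 1 : ℤ[X]) ∣ X ^ (k * n) - 1 := by
    rw [pow_mul]; simpa using sub_one_dvd_pow_sub_one (X ^ k : ℤ[X]) n
  obtain ⟨q, hq⟩ := hdvd
  have h1 : (X ^ (k * n) - 1 : ℤ[X]) ^ (c + 1) = (X ^ (k * n) - 1) * ((X ^ k - 1) ^ c * q ^ c) := by
    rw [pow_succ', ← mul_pow, ← hq]
  have h2 := congrArg (aeval α) h1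
  simp only [map_pow, map_sub, aeval_X, map_one, map_mul] at h2
  rw [h2]
  ext x
  rw [Module.End.mul_apply, Module.End.mul_apply, LinearMap.sub_apply, hαn _ (htors _)]
  simp

end Unipotent

section NilpotentByCyclic

universe u

variable {G : Type u} [Group G] {d : ℕ}

/-- In a group of polynomial growth, every element acts virtually unipotently on a finitely generated
abelian normal subgroup. -/
lemma HasPolynomialGrowth.exists_unipotent_filtration (h : HasPolynomialGrowth G d)
    (Z : Subgroup G) [Z.Normal] (hZ : ∀ x ∈ Z, ∀ y ∈ Z, x * y = y * x) (hfg : Z.FG) (t : G) :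
    ∃ k : ℕ, 0 < k ∧ ∃ c : ℕ, ∃ W : ℕ → Subgroup G, W 0 = ⊥ ∧ W c = Z ∧ (∀ i, W i ≤ Z) ∧
      (∀ i, ∀ x ∈ W i, t * x * t⁻¹ ∈ W i) ∧ (∀ i, ∀ x ∈ W i, t⁻¹ * x * t ∈ W i) ∧
      ∀ i, ∀ x ∈ W (i + 1), x * (t ^ k * x * (t ^ k)⁻¹)⁻¹ ∈ W i := by
  let _ : CommGroup Z := { (inferInstance : Group Z) with
    mul_comm := fun x y => Subtype.ext (hZ x x.2 y y.2) }
  have : Group.FG Z := (Group.fg_iff_subgroup_fg Z).2 hfg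
  have : AddGroup.FG (Additive Z) := inferInstance
  have : Module.Finite ℤ (Additive Z) := Module.Finite.iff_addGroup_fg.2 inferInstance
  let α : Module.End ℤ (Additive Z) :=
    (MonoidHom.toAdditive (MulAut.conjNormal (H := Z) t).toMonoidHom).toIntLinearMap
  have hαj : ∀ j : ℕ, ∀ x : Additive Z,
      (((α ^ j) x).toMul : G) = t ^ j * (x.toMul : G) * (t ^ j)⁻¹ := by
    intro j
    induction j with
    | zero => intro x; simp
    | succ j ih =>
      intro x
      rw [pow_succ', Module.End.mul_apply]
      change t * (((α ^ j) x).toMul : G) * t⁻¹ = _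
      rw [ih, pow_succ']
      group
  have hbij : Function.Bijective α := (MulAut.conjNormal (H := Z) t).bijective
  have hlamp : ∀ (j : ℕ) (e : Additive Z) (l : List Bool),
      ((lampSum (α ^ j) e l).toMul : G) = lampWord (t ^ j) (e.toMul : G) l := by
    intro j e l
    induction l with
    | nil => rfl
    | cons ε l ih =>
      rw [lampSum, lampWord, ← ih, ← hαj, toMul_add, Subgroup.coe_mul]
      cases ε <;> rfl
  obtain ⟨k, hk, c, hc⟩ := exists_pow_sub_one_pow_eq_zero_of_lampSum_eq α hbij (by
    intro j e
    obtain ⟨l, l', h1, h2, h3⟩ := h.exists_lampWord_eq (t ^ j) (e.toMul : G)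
    refine ⟨l, l', h1, h2, ?_⟩
    rw [← hlamp, ← hlamp] at h3
    exact Additive.toMul.injective (Subtype.ext h3))
  let W : ℕ → Subgroup G := fun i =>
    (AddSubgroup.toSubgroup' (LinearMap.ker ((α ^ k - 1) ^ i)).toAddSubgroup).map Z.subtype
  have hW : ∀ i x, x ∈ W i ↔ ∃ y : Additive Z, ((α ^ k - 1) ^ i) y = 0 ∧ (y.toMul : G) = x :=
    fun i x => Iff.rfl
  have hcomm : ∀ (i : ℕ) (y : Additive Z),
      ((α ^ k - 1) ^ i : Module.End ℤ (Additive Z)) (α y) =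
        α (((α ^ k - 1) ^ i : Module.End ℤ (Additive Z)) y) := by
    intro i y
    have : Commute ((α ^ k - 1) ^ i) α :=
      (((Commute.refl α).pow_left k).sub_left (Commute.one_left α)).pow_left i
    exact LinearMap.congr_fun this.eq y
  refine ⟨k, hk, c, W, ?_, ?_, ?_, ?_, ?_, ?_⟩
  · ext x
    rw [hW, Subgroup.mem_bot]
    constructor
    · rintro ⟨y, hy, rfl⟩
      have : y = 0 := by simpa using hy
      rw [this]; rfl
    · rintro rfl
      exact ⟨0, by simp, rfl⟩
  · ext x
    rw [hW, hc]
    constructor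
    · rintro ⟨y, -, rfl⟩
      exact y.toMul.2
    · intro hx
      exact ⟨Additive.ofMul ⟨x, hx⟩, rfl, rfl⟩
  · intro i x
    rw [hW]
    rintro ⟨y, -, rfl⟩
    exact y.toMul.2
  · intro i x
    rw [hW]
    rintro ⟨y, hy, rfl⟩
    exact (hW _ _).2 ⟨α y, by rw [hcomm, hy, map_zero], rfl⟩
  · intro i x
    rw [hW]
    rintro ⟨y, hy, rfl⟩
    obtain ⟨z, rfl⟩ := hbij.2 y
    refine (hW _ _).2 ⟨z, ?_, ?_⟩
    · rw [hcomm] at hy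
      exact hbij.1 (by rw [hy, map_zero])
    · change (z.toMul : G) = t⁻¹ * (t * (z.toMul : G) * t⁻¹) * t
      group
  · intro i x
    rw [hW]
    rintro ⟨y, hy, rfl⟩
    refine (hW _ _).2 ⟨-((α ^ k - 1) y), ?_, ?_⟩
    · rw [pow_succ, Module.End.mul_apply] at hy
      rw [map_neg, hy, neg_zero]
    · rw [LinearMap.sub_apply, neg_sub, Module.End.one_apply, sub_eq_add_neg, toMul_add, toMul_neg,
        Subgroup.coe_mul, Subgroup.coe_inv, hαj]

lemma fg_map {G' : Type*} [Group G'] (f : G →* G') {L : Subgroup G} (hL : L.FG) :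
    (L.map f).FG := by
  classical
  obtain ⟨s, rfl⟩ := hL
  exact ⟨s.image f, by rw [MonoidHom.map_closure, Finset.coe_image]⟩

lemma finiteIndex_sup_zpowers (N : Subgroup G) [N.Normal] {t : G}
    (ht : ∀ g, ∃ k : ℤ, g * t ^ k ∈ N) {k : ℕ} (hk : 0 < k) :
    (N ⊔ Subgroup.zpowers (t ^ k)).FiniteIndex := by
  set M := N ⊔ Subgroup.zpowers (t ^ k)
  have : Finite (G ⧸ M) := by
    refine Finite.of_surjective (fun r : Fin k => ((t ^ (r : ℕ) : G) : G ⧸ M)) fun q => ?_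
    obtain ⟨g, rfl⟩ := QuotientGroup.mk_surjective q
    obtain ⟨j, hj⟩ := ht g
    have hk' : (0 : ℤ) < k := by exact_mod_cast hk
    have h0 := Int.emod_nonneg (-j) hk'.ne'
    have h1 := Int.emod_lt_of_pos (-j) hk'
    refine ⟨⟨((-j) % k).toNat, by omega⟩, ?_⟩
    rw [QuotientGroup.eq]
    have h2 : (t ^ ((-j) % (k : ℤ)).toNat : G) = t ^ ((-j) % (k : ℤ)) := by
      rw [← zpow_natCast, Int.toNat_of_nonneg h0]
    have h3 : (-j) % (k : ℤ) = -j - k * ((-j) / k) := by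
      have := Int.emod_add_mul_ediv (-j) k; omega
    have h4 : (t ^ j * g) ∈ N := (inferInstance : N.Normal).mem_comm hj
    have h5 : (t ^ k) ^ ((-j) / (k : ℤ)) ∈ Subgroup.zpowers (t ^ k) := ⟨_, rfl⟩
    have h6 := mul_mem (show _ ∈ M from Subgroup.mem_sup_right h5)
      (show _ ∈ M from Subgroup.mem_sup_left h4)
    have h7 : (t ^ ((-j) % (k : ℤ)).toNat : G)⁻¹ * g =
        (t ^ k) ^ ((-j) / (k : ℤ)) * (t ^ j * g) := by
      rw [h2, h3, ← zpow_natCast, ← zpow_mul, ← mul_assoc, ← zpow_add, ← zpow_neg]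
      congr 2; ring
    simp only
    rw [h7]
    exact h6
  exact Subgroup.finiteIndex_of_finite_quotient

/-- A nilpotent-by-cyclic group of polynomial growth is virtually nilpotent. -/
lemma HasPolynomialGrowth.exists_isNilpotent_of_nilpotent_by_cyclic (n : ℕ) :
    ∀ {G : Type u} [Group G] (_ : HasPolynomialGrowth G d) (N : Subgroup G) [N.Normal]
      (_ : N.lowerCentralSeries n = ⊥) (_ : ∀ L ≤ N, L.FG) (t : G)
      (_ : ∀ g, ∃ k : ℤ, g * t ^ k ∈ N),
      ∃ H : Subgroup G, H.FiniteIndex ∧ Group.IsNilpotent H := by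
  induction n with
  | zero =>
    intro G _ h N _ hN hfg t ht
    rw [Subgroup.lowerCentralSeries_zero] at hN
    subst hN
    have htop : Subgroup.zpowers t = ⊤ := by
      refine Subgroup.eq_top_iff' _ |>.2 fun g => ?_
      obtain ⟨k, hk⟩ := ht g
      refine ⟨-k, ?_⟩
      rw [Subgroup.mem_bot, mul_eq_one_iff_eq_inv, ← zpow_neg] at hk
      exact hk.symm
    refine ⟨Subgroup.zpowers t, by rw [htop]; infer_instance, ?_⟩
    exact @CommGroup.isNilpotent _ (IsCyclic.commGroup)
  | succ n ih =>
    intro G _ h N _ hN hfg t ht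
    set Z := N.lowerCentralSeries n with hZdef
    have hZN : Z ≤ N := N.lowerCentralSeries_le_self n
    have hcent : ∀ z ∈ Z, ∀ x ∈ N, x * z = z * x := by
      intro z hz x hx
      rw [Subgroup.lowerCentralSeries_succ, ← le_bot_iff, Subgroup.commutator_le] at hN
      have := hN z hz x hx
      rw [Subgroup.mem_bot, commutatorElement_eq_one_iff_mul_comm] at this
      exact this.symm
    obtain ⟨k, hk, c, W, hW0, hWc, hWZ, hWt, hWt', hWk⟩ := h.exists_unipotent_filtration Z
      (fun x hx y hy => hcent y hy x (hZN hx)) (hfg Z hZN) t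
    set π := QuotientGroup.mk' Z with hπ
    have hπs : Function.Surjective π := QuotientGroup.mk'_surjective Z
    have hker : π.ker = Z := QuotientGroup.ker_mk' Z
    have hNn : (N.map π).Normal := Subgroup.Normal.map inferInstance π hπs
    obtain ⟨H, hH, hHn⟩ := ih (h.of_surjective π hπs) (N.map π)
      (by
        rw [← Subgroup.map_lowerCentralSeries, Subgroup.map_eq_bot_iff, hker])
      (by
        intro L hL
        rw [← Subgroup.map_comap_eq_self_of_surjective hπs L]
        refine fg_map π (hfg _ ?_)
        have h1 := Subgroup.comap_mono (f := π) hL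
        rw [Subgroup.comap_map_eq, hker, sup_eq_left.2 hZN] at h1
        exact h1)
      (π t)
      (by
        intro g
        obtain ⟨g, rfl⟩ := hπs g
        obtain ⟨k, hk⟩ := ht g
        exact ⟨k, by rw [← map_zpow, ← map_mul]; exact Subgroup.mem_map_of_mem π hk⟩)
    obtain ⟨m, hm⟩ := (Subgroup.isNilpotent_iff_lowerCentralSeries H).1 hHn
    have hMfin := finiteIndex_sup_zpowers N ht hk
    set M := N ⊔ Subgroup.zpowers (t ^ k) with hM
    have hHfin : (H.comap π).FiniteIndex :=
      ⟨by rw [Subgroup.index_comap_of_surjective _ hπs]; exact hH.index_ne_zero⟩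
    refine ⟨H.comap π ⊓ M, inferInstance, ?_⟩
    set H' := H.comap π ⊓ M with hH'
    have hmZ : H'.lowerCentralSeries m ≤ Z := by
      rw [← hker, ← Subgroup.map_eq_bot_iff, Subgroup.map_lowerCentralSeries, eq_bot_iff, ← hm]
      exact Subgroup.lowerCentralSeries_mono m
        ((Subgroup.map_mono inf_le_left).trans (Subgroup.map_comap_le π H))
    have hWj : ∀ (j : ℤ) (i : ℕ), ∀ x ∈ W i, t ^ j * x * (t ^ j)⁻¹ ∈ W i := fun j i =>
      conj_zpow_mem (hWt i) (hWt' i) j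
    have hWkj : ∀ (j : ℤ) (i : ℕ), ∀ x ∈ W (i + 1),
        x * ((t ^ k) ^ j * x * ((t ^ k) ^ j)⁻¹)⁻¹ ∈ W i := by
      intro j i
      have hconj : ∀ j : ℤ, ∀ x ∈ W (i + 1), (t ^ k) ^ j * x * ((t ^ k) ^ j)⁻¹ ∈ W (i + 1) := by
        intro j x hx
        rw [← zpow_natCast, ← zpow_mul]
        exact hWj _ _ x hx
      induction j using Int.induction_on with
      | zero => intro x _; simp [one_mem]
      | succ j ih =>
        intro x hx
        have h1 := mul_mem (ih x hx) (hWk i _ (hconj j x hx))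
        rw [add_comm, zpow_add, zpow_one]
        convert h1 using 1
        group
      | pred j ih =>
        intro x hx
        have h1 := mul_mem (ih x hx) (inv_mem (hWk i _ (hconj (-j - 1) x hx)))
        convert h1 using 1
        rw [sub_eq_add_neg, add_comm, zpow_add]
        group
    have hlcs : ∀ i j, i + j = c → H'.lowerCentralSeries (m + i) ≤ W j := by
      intro i
      induction i with
      | zero =>
        intro j hj
        rw [zero_add] at hj
        rw [hj, hWc]; exact hmZ
      | succ i ihi =>
        intro j hj
        rw [← add_assoc, Subgroup.lowerCentralSeries_succ, Subgroup.commutator_le]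
        intro x hx y hy
        have hxW := ihi (j + 1) (by omega) hx
        obtain ⟨a, ha, b, ⟨r, rfl⟩, rfl⟩ := Subgroup.mem_sup_of_normal_left.1 hy.2
        have h1 := hWkj r j x hxW
        have h2 : a * ((t ^ k) ^ r * x * ((t ^ k) ^ r)⁻¹) * a⁻¹ =
            (t ^ k) ^ r * x * ((t ^ k) ^ r)⁻¹ := by
          rw [hcent _ ((inferInstance : Z.Normal).conj_mem x (hWZ _ hxW) _) a ha]
          group
        convert h1 using 1
        rw [← h2]
        simp only [commutatorElement_def]
        group
    refine Subgroup.isNilpotent_of_lowerCentralSeries_eq_bot (n := m + c) ?_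
    rw [← le_bot_iff, ← hW0]
    exact hlcs c 0 (by omega)

end NilpotentByCyclic

section Linear

open scoped commutatorElement

universe u

variable {G : Type u} [Group G] {d : ℕ}

lemma isNilpotent_of_foldl_commutator_eq_one (m : ℕ) :
    ∀ {G : Type u} [Group G] (S : Set G) (_ : Subgroup.closure S = ⊤)
      (_ : ∀ s ∈ S, ∀ l : List G, (∀ x ∈ l, x ∈ S) → l.length = m →
        l.foldl (fun a b => ⁅a, b⁆) s = 1), Group.IsNilpotent G := by
  induction m with
  | zero =>
    intro G _ S hS h
    have hS1 : S ⊆ {1} := fun s hs => h s hs [] (by simp) rfl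
    have : Subsingleton G := by
      refine subsingleton_of_forall_eq 1 fun g => ?_
      have hg : g ∈ Subgroup.closure S := by rw [hS]; trivial
      have := Subgroup.closure_mono hS1 hg
      rwa [Subgroup.closure_singleton_one, Subgroup.mem_bot] at this
    infer_instance
  | succ m ih =>
    intro G _ S hS h
    refine Group.of_quotient_center_nilpotent (ih (QuotientGroup.mk' (Subgroup.center G) '' S) ?_ ?_)
    · rw [← MonoidHom.map_closure, hS, ← MonoidHom.range_eq_map, MonoidHom.range_eq_top]
      exact QuotientGroup.mk'_surjective _
    · rintro _ ⟨s, hs, rfl⟩ l hl hlen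
      obtain ⟨l, hlS, rfl⟩ : ∃ l' : List G, (∀ x ∈ l', x ∈ S) ∧
          l'.map (QuotientGroup.mk' (Subgroup.center G)) = l := by
        clear hlen
        induction l with
        | nil => exact ⟨[], by simp, rfl⟩
        | cons a l ihl =>
          obtain ⟨l', h1, rfl⟩ := ihl fun x hx => hl x (List.mem_cons_of_mem _ hx)
          obtain ⟨b, hb, rfl⟩ := hl a List.mem_cons_self
          exact ⟨b :: l', by simpa [hb] using h1, rfl⟩
      have hfold : ∀ (l : List G) (g : G),
          (l.map (QuotientGroup.mk' (Subgroup.center G))).foldl (fun a b => ⁅a, b⁆)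
            (QuotientGroup.mk' (Subgroup.center G) g) =
          QuotientGroup.mk' (Subgroup.center G) (l.foldl (fun a b => ⁅a, b⁆) g) := by
        intro l
        induction l with
        | nil => intro g; rfl
        | cons a l ihl =>
          intro g
          rw [List.map_cons, List.foldl_cons, List.foldl_cons, ← map_commutatorElement, ihl]
      rw [hfold, ← MonoidHom.mem_ker, QuotientGroup.ker_mk', Subgroup.mem_center_iff]
      set c := l.foldl (fun a b => ⁅a, b⁆) s with hc
      have hcS : ∀ x ∈ S, x * c = c * x := by
        intro x hx
        have h1 := h s hs (l ++ [x]) (by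
          intro y hy
          rcases List.mem_append.1 hy with hy | hy
          · exact hlS y hy
          · rw [List.mem_singleton] at hy; rwa [hy]) (by simpa using hlen)
        rw [List.foldl_append, List.foldl_cons, List.foldl_nil, ← hc,
          commutatorElement_eq_one_iff_mul_comm] at h1
        exact h1.symm
      have hle : Subgroup.closure S ≤ Subgroup.centralizer {c} := by
        rw [Subgroup.closure_le]
        intro x hx
        rw [SetLike.mem_coe, Subgroup.mem_centralizer_singleton_iff]
        exact hcS x hx
      intro g
      have := hle (by rw [hS]; trivial : g ∈ Subgroup.closure S)
      rwa [Subgroup.mem_centralizer_singleton_iff] at this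

lemma exists_finite_subset_of_mem_closure {T : Set G} {x : G} (hx : x ∈ Subgroup.closure T) :
    ∃ F ⊆ T, F.Finite ∧ x ∈ Subgroup.closure F := by
  induction hx using Subgroup.closure_induction with
  | mem x hx => exact ⟨{x}, by simpa using hx, Set.finite_singleton x,
      Subgroup.subset_closure rfl⟩
  | one => exact ⟨∅, by simp, Set.finite_empty, one_mem _⟩
  | mul x y _ _ hx hy =>
    obtain ⟨F, h1, h2, h3⟩ := hx
    obtain ⟨F', h1', h2', h3'⟩ := hy
    exact ⟨F ∪ F', Set.union_subset h1 h1', h2.union h2',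
      mul_mem (Subgroup.closure_mono Set.subset_union_left h3)
        (Subgroup.closure_mono Set.subset_union_right h3')⟩
  | inv x _ hx =>
    obtain ⟨F, h1, h2, h3⟩ := hx
    exact ⟨F, h1, h2, inv_mem h3⟩

lemma exists_finite_subset_closure_eq {T : Set G} (h : (Subgroup.closure T).FG) :
    ∃ F ⊆ T, F.Finite ∧ Subgroup.closure F = Subgroup.closure T := by
  obtain ⟨E, hE⟩ := h
  have h1 : ∀ x : E, ∃ F ⊆ T, F.Finite ∧ (x : G) ∈ Subgroup.closure F := fun x =>
    exists_finite_subset_of_mem_closure (hE ▸ Subgroup.subset_closure x.2)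
  choose F hF hfin hmem using h1
  refine ⟨⋃ x, F x, Set.iUnion_subset hF, Set.finite_iUnion hfin, le_antisymm
    (Subgroup.closure_mono (Set.iUnion_subset hF)) ?_⟩
  rw [← hE, Subgroup.closure_le]
  exact fun x hx => Subgroup.closure_mono (Set.subset_iUnion F ⟨x, hx⟩) (hmem ⟨x, hx⟩)

variable {A : Type*} [NormedRing A] (ρ : G →* A)

section Displacement

variable {ρ} (hρ : ∀ g, ‖ρ g‖ ≤ 1)

include hρ

lemma norm_map_mul_le (g : G) (a : A) : ‖ρ g * a‖ ≤ ‖a‖ :=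
  (norm_mul_le _ _).trans (mul_le_of_le_one_left (norm_nonneg _) (hρ g))

lemma norm_mul_map_le (g : G) (a : A) : ‖a * ρ g‖ ≤ ‖a‖ :=
  (norm_mul_le _ _).trans (mul_le_of_le_one_right (norm_nonneg _) (hρ g))

lemma norm_map_mul_sub_one_le (g h : G) : ‖ρ (g * h) - 1‖ ≤ ‖ρ g - 1‖ + ‖ρ h - 1‖ := by
  have : ρ (g * h) - 1 = (ρ g - 1) + ρ g * (ρ h - 1) := by rw [map_mul]; noncomm_ring
  rw [this]
  exact (norm_add_le _ _).trans (add_le_add_right (norm_map_mul_le hρ g _) _)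

lemma norm_map_inv_sub_one_le (g : G) : ‖ρ g⁻¹ - 1‖ ≤ ‖ρ g - 1‖ := by
  have : ρ g⁻¹ - 1 = -(ρ g⁻¹ * (ρ g - 1)) := by
    rw [mul_sub, ← map_mul, inv_mul_cancel, map_one, mul_one, neg_sub]
  rw [this, norm_neg]
  exact norm_map_mul_le hρ _ _

lemma norm_map_pow_sub_one_le (g : G) (a : ℕ) : ‖ρ (g ^ a) - 1‖ ≤ a * ‖ρ g - 1‖ := by
  induction a with
  | zero => simp
  | succ a ih =>
    rw [pow_succ]
    refine (norm_map_mul_sub_one_le hρ _ _).trans ?_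
    push_cast
    linarith

lemma norm_map_commutator_sub_one_le (g h : G) :
    ‖ρ ⁅g, h⁆ - 1‖ ≤ 2 * ‖ρ h - 1‖ * ‖ρ g - 1‖ := by
  have h1 : ρ ⁅g, h⁆ - 1 =
      ((ρ g - 1) * (ρ h - 1) - (ρ h - 1) * (ρ g - 1)) * ρ (g⁻¹ * h⁻¹) := by
    have h2 : (ρ g - 1) * (ρ h - 1) - (ρ h - 1) * (ρ g - 1) = ρ (g * h) - ρ (h * g) := by
      rw [map_mul, map_mul]; noncomm_ring
    rw [h2, sub_mul, ← map_mul, ← map_mul, commutatorElement_def]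
    congr 1
    · congr 1; group
    · rw [show h * g * (g⁻¹ * h⁻¹) = 1 by group, map_one]
  rw [h1]
  refine (norm_mul_map_le hρ _ _).trans ((norm_sub_le _ _).trans ?_)
  have h3 := norm_mul_le (ρ g - 1) (ρ h - 1)
  have h4 := norm_mul_le (ρ h - 1) (ρ g - 1)
  nlinarith

lemma half_le_norm_map_pow_sub_one [NormedAlgebra ℝ A] (g : G) {a : ℕ} (ha : 1 ≤ a)
    (h : a * ‖ρ g - 1‖ ≤ 1 / 2) : ‖ρ g - 1‖ / 2 ≤ ‖ρ (g ^ a) - 1‖ := by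
  have key : ∀ a : ℕ, ‖ρ (g ^ a) - 1 - (a : ℝ) • (ρ g - 1)‖ ≤ a * (a * ‖ρ g - 1‖) * ‖ρ g - 1‖ := by
    intro a
    induction a with
    | zero => simp
    | succ a ih =>
      have h1 : ρ (g ^ (a + 1)) - 1 - ((a + 1 : ℕ) : ℝ) • (ρ g - 1) =
          (ρ (g ^ a) - 1 - (a : ℝ) • (ρ g - 1)) + (ρ (g ^ a) - 1) * (ρ g - 1) := by
        rw [pow_succ, map_mul]
        push_cast
        rw [add_smul, one_smul]
        noncomm_ring
      rw [h1]
      have h2 := norm_mul_le (ρ (g ^ a) - 1) (ρ g - 1)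
      have h3 := mul_le_mul_of_nonneg_right (norm_map_pow_sub_one_le hρ g a)
        (norm_nonneg (ρ g - 1))
      refine (norm_add_le _ _).trans ((add_le_add ih (h2.trans h3)).trans ?_)
      push_cast
      have := norm_nonneg (ρ g - 1)
      nlinarith [mul_nonneg this this, mul_nonneg (Nat.cast_nonneg (α := ℝ) a) (mul_nonneg this this)]
  have h1 := key a
  have h2 := norm_sub_norm_le ((a : ℝ) • (ρ g - 1)) (ρ (g ^ a) - 1)
  rw [norm_sub_rev ((a : ℝ) • (ρ g - 1)), norm_smul, Real.norm_natCast] at h2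
  have h3 := norm_nonneg (ρ g - 1)
  have ha' : (1 : ℝ) ≤ a := by exact_mod_cast ha
  have h4 : (a : ℝ) * (a * ‖ρ g - 1‖) * ‖ρ g - 1‖ ≤ a * (1 / 2) * ‖ρ g - 1‖ := by gcongr
  nlinarith

end Displacement

/-- Powers of successive commutators of elements close to the identity have many distinct
products. -/
lemma exists_large_finset_of_foldl_commutator_ne_one [DecidableEq G] [NormedAlgebra ℝ A]
    (hinj : Function.Injective ρ)
    (hρ : ∀ g, ‖ρ g‖ ≤ 1) {K : ℕ} (hK : 1 ≤ K) {ε : ℝ} (hε : 16 * K * ε < 1) {F : Finset G}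
    (h1 : 1 ∈ F) (hinv : F⁻¹ = F) (hF : ∀ s ∈ F, ‖ρ s - 1‖ ≤ ε) (l : List G) :
    ∀ (n : ℕ) (g : G), 1 ≤ n → g ∈ F ^ n → ‖ρ g - 1‖ ≤ ε → (∀ s ∈ l, s ∈ F) →
      l.foldl (fun a b => ⁅a, b⁆) g ≠ 1 →
      ∃ (P : Finset G) (N : ℕ), N + K * n ≤ 2 * 4 ^ l.length * (K * n) ∧ P ⊆ F ^ N ∧
        P.card = (K + 1) ^ (l.length + 1) ∧ ∀ p ∈ P, ‖ρ p - 1‖ ≤ 2 * K * ‖ρ g - 1‖ := by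
  have hK' : (1 : ℝ) ≤ K := by exact_mod_cast hK
  have hpos : ∀ g : G, g ≠ 1 → 0 < ‖ρ g - 1‖ := by
    intro g hg
    rw [norm_pos_iff, sub_ne_zero, ← map_one ρ]
    exact hinj.ne hg
  have hone : ∀ l : List G, l.foldl (fun a b => ⁅a, b⁆) (1 : G) = 1 := by
    intro l
    induction l with
    | nil => rfl
    | cons a l ih => rw [List.foldl_cons, commutatorElement_one_left, ih]
  have hsep : ∀ (g : G), ‖ρ g - 1‖ ≤ ε → g ≠ 1 → ∀ (a b : ℕ) (p q : G), a ≤ K → b < a →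
      ‖ρ p - 1‖ ≤ 4 * K * ε * ‖ρ g - 1‖ → ‖ρ q - 1‖ ≤ 4 * K * ε * ‖ρ g - 1‖ →
      g ^ a * p ≠ g ^ b * q := by
    intro g hgε hg a b p q haK hab hp hq heq
    have h2 : g ^ (a - b) = q * p⁻¹ := by
      rw [eq_mul_inv_iff_mul_eq, ← mul_right_inj (g ^ b), ← heq, ← mul_assoc, ← pow_add,
        Nat.add_sub_cancel' hab.le]
    have h3 : ((a - b : ℕ) : ℝ) ≤ K := by exact_mod_cast (Nat.sub_le a b).trans haK
    have h4 := half_le_norm_map_pow_sub_one hρ g (a := a - b) (by omega) (by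
      have := mul_le_mul h3 hgε (norm_nonneg _) (by positivity)
      nlinarith)
    rw [h2] at h4
    have h5 := (norm_map_mul_sub_one_le hρ q p⁻¹).trans
      (add_le_add_right (norm_map_inv_sub_one_le hρ p) _)
    have := hpos g hg
    nlinarith
  induction l with
  | nil =>
    intro n g hn hg hgε _ hne
    refine ⟨(Finset.range (K + 1)).image (g ^ ·), K * n, by simp; omega, ?_, ?_, ?_⟩
    · intro p hp
      obtain ⟨a, ha, rfl⟩ := Finset.mem_image.1 hp
      rw [Finset.mem_range] at ha
      refine Finset.pow_subset_pow_right h1 (Nat.mul_le_mul_right n (Nat.le_of_lt_succ ha)) ?_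
      rw [mul_comm a n, pow_mul]
      exact Finset.pow_mem_pow hg
    · rw [Finset.card_image_of_injOn, Finset.card_range]
      · simp
      · have hz : ‖ρ (1 : G) - 1‖ ≤ 4 * K * ε * ‖ρ g - 1‖ := by
          rw [map_one, sub_self, norm_zero]
          have := (norm_nonneg _).trans hgε
          positivity
        intro a ha b hb hab
        simp only [Finset.coe_range, Set.mem_Iio] at ha hb hab
        rcases lt_trichotomy a b with h | h | h
        · exact (hsep g hgε hne b a 1 1 (by omega) h hz hz (by simpa using hab.symm)).elim
        · exact h
        · exact (hsep g hgε hne a b 1 1 (by omega) h hz hz (by simpa using hab)).elim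
    · intro p hp
      obtain ⟨a, ha, rfl⟩ := Finset.mem_image.1 hp
      rw [Finset.mem_range] at ha
      have ha' : (a : ℝ) ≤ K := by exact_mod_cast Nat.le_of_lt_succ ha
      refine (norm_map_pow_sub_one_le hρ g a).trans ?_
      gcongr
      linarith
  | cons s l ih =>
    intro n g hn hg hgε hl hne
    have hs : s ∈ F := hl s List.mem_cons_self
    have hε0 : 0 ≤ ε := (norm_nonneg _).trans hgε
    have hε1 : 16 * ε < 1 := by nlinarith
    have hg1 : g ≠ 1 := by
      rintro rfl
      exact hne (hone _)
    have hcε : ‖ρ ⁅g, s⁆ - 1‖ ≤ 2 * ε * ‖ρ g - 1‖ :=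
      (norm_map_commutator_sub_one_le hρ g s).trans (by gcongr; exact hF s hs)
    have hinvn : g⁻¹ ∈ F ^ n := by
      rw [← hinv, inv_pow]
      exact Finset.inv_mem_inv hg
    have hs' : s⁻¹ ∈ F := by rw [← hinv]; exact Finset.inv_mem_inv hs
    have hc : ⁅g, s⁆ ∈ F ^ (4 * n) := by
      refine Finset.pow_subset_pow_right h1 (by omega : n + 1 + n + 1 ≤ 4 * n) ?_
      rw [commutatorElement_def, pow_succ, pow_add, pow_succ]
      exact Finset.mul_mem_mul (Finset.mul_mem_mul (Finset.mul_mem_mul hg hs) hinvn) hs'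
    obtain ⟨P, N, hN, hP, hcard, hsmall⟩ := ih (4 * n) ⁅g, s⁆ (by omega) hc
      (hcε.trans (by nlinarith [norm_nonneg (ρ g - 1)]))
      (fun x hx => hl x (List.mem_cons_of_mem _ hx)) hne
    have hsm : ∀ p ∈ P, ‖ρ p - 1‖ ≤ 4 * K * ε * ‖ρ g - 1‖ := by
      intro p hp
      refine (hsmall p hp).trans ?_
      calc 2 * K * ‖ρ ⁅g, s⁆ - 1‖ ≤ 2 * K * (2 * ε * ‖ρ g - 1‖) := by gcongr
        _ = _ := by ring
    refine ⟨(Finset.range (K + 1) ×ˢ P).image (fun x => g ^ x.1 * x.2), K * n + N, ?_, ?_, ?_, ?_⟩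
    · rw [List.length_cons, pow_succ]
      have h5 : 1 ≤ K * n := Nat.mul_pos hK hn
      nlinarith
    · intro p hp
      obtain ⟨⟨a, q⟩, haq, rfl⟩ := Finset.mem_image.1 hp
      obtain ⟨ha, hq⟩ := Finset.mem_product.1 haq
      rw [Finset.mem_range] at ha
      rw [pow_add]
      refine Finset.mul_mem_mul ?_ (hP hq)
      refine Finset.pow_subset_pow_right h1 (Nat.mul_le_mul_right n (Nat.le_of_lt_succ ha)) ?_
      rw [mul_comm a n, pow_mul]
      exact Finset.pow_mem_pow hg
    · rw [Finset.card_image_of_injOn, Finset.card_product, Finset.card_range, hcard,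
        List.length_cons, ← pow_succ']
      rintro ⟨a, p⟩ hx ⟨b, q⟩ hy hab
      simp only [Finset.coe_product, Finset.coe_range, Set.mem_prod, Set.mem_Iio,
        Finset.mem_coe] at hx hy hab
      rcases lt_trichotomy a b with h | h | h
      · exact (hsep g hgε hg1 b a q p (by omega) h (hsm q hy.2) (hsm p hx.2) hab.symm).elim
      · subst h
        rw [mul_right_inj] at hab
        rw [hab]
      · exact (hsep g hgε hg1 a b p q (by omega) h (hsm p hx.2) (hsm q hy.2) hab).elim
    · intro p hp
      obtain ⟨⟨a, q⟩, haq, rfl⟩ := Finset.mem_image.1 hp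
      obtain ⟨ha, hq⟩ := Finset.mem_product.1 haq
      rw [Finset.mem_range] at ha
      have ha' : (a : ℝ) ≤ K := by exact_mod_cast Nat.le_of_lt_succ ha
      refine (norm_map_mul_sub_one_le hρ _ _).trans ?_
      have h5 := (norm_map_pow_sub_one_le hρ g a).trans
        (mul_le_mul_of_nonneg_right ha' (norm_nonneg _))
      have h6 := hsm q hq
      have h7 : 4 * K * ε * ‖ρ g - 1‖ ≤ K * ‖ρ g - 1‖ := by
        gcongr
        nlinarith
      simp only
      linarith

end Linear

section LinearNilpotent

open scoped commutatorElement

universe u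

variable {G : Type u} [Group G] {d : ℕ} {A : Type*} [NormedRing A] [NormedAlgebra ℝ A]

lemma HasPolynomialGrowth.isNilpotent_of_norm_sub_one_le (h : HasPolynomialGrowth G d) {ρ : G →* A}
    (hinj : Function.Injective ρ) (hρ : ∀ g, ‖ρ g‖ ≤ 1) {F : Finset G} {ε : ℝ}
    (hε : 16 * ((2 * 4 ^ d - 1 : ℕ) : ℝ) * ε < 1) (hF : ∀ s ∈ F, ‖ρ s - 1‖ ≤ ε)
    (h1 : 1 ∈ F) (hinv : (F : Set G)⁻¹ = F)
    (hgen : Subgroup.closure (F : Set G) = ⊤) : Group.IsNilpotent G := by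
  classical
  set K := 2 * 4 ^ d - 1 with hKdef
  have h4 : 1 ≤ 4 ^ d := Nat.one_le_pow _ _ (by norm_num)
  have hK : 1 ≤ K := by omega
  have hK1 : K + 1 = 2 * 4 ^ d := by omega
  have hinv' : F⁻¹ = F := by
    rw [← Finset.coe_inj, Finset.coe_inv, hinv]
  obtain ⟨C, hC⟩ := h.exists_card_le F
  set m := C * (2 * K) ^ d with hm
  refine isNilpotent_of_foldl_commutator_eq_one m (F : Set G) hgen fun s hs l hl hlen => ?_
  by_contra hne
  obtain ⟨P, N, hN, hP, hcard, -⟩ := exists_large_finset_of_foldl_commutator_ne_one ρ hinj hρ hK hε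
    h1 hinv' hF l 1 s le_rfl (by simpa using hs) (hF s hs) hl hne
  have h2 := (Finset.card_le_card hP).trans (hC N)
  rw [hlen, mul_one] at hN
  rw [hcard, hlen] at h2
  have h3 : C * (N + 1) ^ d ≤ m * (4 ^ d) ^ m := by
    calc C * (N + 1) ^ d ≤ C * (2 * 4 ^ m * K) ^ d :=
          Nat.mul_le_mul_left _ (Nat.pow_le_pow_left (by omega) _)
      _ = m * (4 ^ d) ^ m := by
          rw [hm, ← pow_mul, mul_comm d m, pow_mul]
          ring
  have h5 : 2 ^ m * (4 ^ d) ^ m ≤ (K + 1) ^ (m + 1) := by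
    rw [← mul_pow, ← hK1]
    exact Nat.pow_le_pow_right (by omega) (by omega)
  have h6 : m * (4 ^ d) ^ m < 2 ^ m * (4 ^ d) ^ m :=
    Nat.mul_lt_mul_of_pos_right Nat.lt_two_pow_self (by positivity)
  omega

lemma finiteIndex_closure_norm_sub_one_lt [FiniteDimensional ℝ A] {ρ : G →* A}
    (hρ : ∀ g, ‖ρ g‖ ≤ 1) {ε : ℝ} (hε : 0 < ε) :
    (Subgroup.closure {g | ‖ρ g - 1‖ < ε}).FiniteIndex := by
  set H := Subgroup.closure {g | ‖ρ g - 1‖ < ε}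
  have : ProperSpace A := FiniteDimensional.proper ℝ A
  obtain ⟨t, ht, hcov⟩ := Metric.totallyBounded_iff.1
    (isCompact_closedBall (0 : A) 1).totallyBounded (ε / 2) (half_pos hε)
  have h1 : ∀ g, ∃ y : t, ρ g ∈ Metric.ball (y : A) (ε / 2) := by
    intro g
    have := hcov (show ρ g ∈ Metric.closedBall (0 : A) 1 by simpa using hρ g)
    simp only [Set.mem_iUnion] at this
    obtain ⟨y, hy, hg⟩ := this
    exact ⟨⟨y, hy⟩, hg⟩
  choose y hy using h1
  have hfin : Finite t := ht
  have : Finite (G ⧸ H) := by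
    refine Finite.of_injective (fun q : G ⧸ H => y q.out) fun p q hpq => ?_
    rw [← QuotientGroup.out_eq' p, ← QuotientGroup.out_eq' q, QuotientGroup.eq]
    refine Subgroup.subset_closure ?_
    have h2 : ρ ((p.out)⁻¹ * q.out) - 1 = ρ (p.out)⁻¹ * (ρ q.out - ρ p.out) := by
      rw [mul_sub, ← map_mul, ← map_mul, inv_mul_cancel, map_one]
    change ‖_‖ < ε
    rw [h2]
    refine (norm_map_mul_le hρ _ _).trans_lt ?_
    have h3 := hy q.out
    have h4 := hy p.out
    simp only at hpq
    rw [hpq] at h4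
    rw [Metric.mem_ball] at h3 h4
    rw [← dist_eq_norm]
    have := dist_triangle_right (ρ q.out) (ρ p.out) (y q.out : A)
    linarith
  exact Subgroup.finiteIndex_of_finite_quotient

/-- A finitely generated linear group of contractions of polynomial growth is virtually nilpotent. -/
lemma HasPolynomialGrowth.exists_isNilpotent_of_linear [FiniteDimensional ℝ A] [Group.FG G]
    (h : HasPolynomialGrowth G d) {ρ : G →* A} (hinj : Function.Injective ρ)
    (hρ : ∀ g, ‖ρ g‖ ≤ 1) : ∃ H : Subgroup G, H.FiniteIndex ∧ Group.IsNilpotent H := by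
  classical
  obtain ⟨ε, hε, hε'⟩ : ∃ ε : ℝ, 0 < ε ∧ 16 * ((2 * 4 ^ d - 1 : ℕ) : ℝ) * ε < 1 := by
    set K : ℝ := ((2 * 4 ^ d - 1 : ℕ) : ℝ)
    have hK : 0 ≤ K := Nat.cast_nonneg _
    refine ⟨1 / (16 * K + 1), by positivity, ?_⟩
    rw [mul_one_div, div_lt_one (by positivity)]
    linarith
  have hfin := finiteIndex_closure_norm_sub_one_lt hρ hε
  set T := {g | ‖ρ g - 1‖ < ε} with hT
  set H := Subgroup.closure T with hH
  refine ⟨H, hfin, ?_⟩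
  have hHfg : Group.FG H := inferInstance
  have htop : Subgroup.closure (((↑) : H → G) ⁻¹' T) = ⊤ := Subgroup.closure_closure_coe_preimage
  obtain ⟨F, hFT, hFfin, hF⟩ := exists_finite_subset_closure_eq (T := ((↑) : H → G) ⁻¹' T)
    (by rw [htop]; exact Group.fg_def.1 hHfg)
  rw [htop] at hF
  have hfin' : (F ∪ F⁻¹ ∪ {1}).Finite := (hFfin.union hFfin.inv).union (Set.finite_singleton 1)
  refine (h.subgroup H).isNilpotent_of_norm_sub_one_le (ρ := ρ.comp H.subtype)
    (hinj.comp H.subtype_injective) (fun g => hρ _) (F := hfin'.toFinset) hε' ?_ (by simp) ?_ ?_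
  · intro s hs
    rw [Set.Finite.mem_toFinset] at hs
    rcases hs with (hs | hs) | rfl
    · exact (hFT hs).le
    · have := (norm_map_inv_sub_one_le hρ ((s⁻¹ : H) : G)).trans (hFT hs).le
      simpa using this
    · simpa using hε.le
  · rw [Set.Finite.coe_toFinset, Set.union_inv, Set.union_inv, inv_inv, Set.union_comm F⁻¹]
    simp
  · rw [Set.Finite.coe_toFinset, eq_top_iff, ← hF]
    exact Subgroup.closure_mono (Set.subset_union_left.trans Set.subset_union_left)

end LinearNilpotent

section VirtualSurjection

open scoped commutatorElement

universe u v

variable {G : Type u} [Group G] {d : ℕ}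

lemma exists_map_eq_ofAdd_one_of_infinite_range [Group.FG G] {M : Type v} [CommGroup M] (f : G →* M)
    (hf : (Set.range f).Infinite) :
    ∃ φ : G →* Multiplicative ℤ, ∃ t, φ t = Multiplicative.ofAdd 1 := by
  have hR : Group.FG f.range := Group.fg_of_surjective f.rangeRestrict_surjective
  have : AddGroup.FG (Additive f.range) := inferInstance
  obtain ⟨n, ι, _, p, hp, e, ⟨E⟩⟩ := AddCommGroup.equiv_free_prod_directSum_zmod (Additive f.range)
  rcases n with _ | n
  · exfalso
    have : ∀ i, NeZero (p i ^ e i) := fun i => ⟨pow_ne_zero _ (hp i).ne_zero⟩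
    have : Finite (DirectSum ι fun i => ZMod (p i ^ e i)) :=
      Finite.of_equiv _ DFinsupp.equivFunOnFintype.symm
    have : Finite (Additive f.range) := Finite.of_equiv _ E.symm.toEquiv
    have : Finite f.range := Finite.of_equiv _ Additive.ofMul.symm
    exact hf (Set.toFinite (f.range : Set M))
  · let ψ : Additive f.range →+ ℤ :=
      (Finsupp.applyAddHom (0 : Fin (n + 1))).comp ((AddMonoidHom.fst _ _).comp E.toAddMonoidHom)
    obtain ⟨x, hx⟩ : ∃ x, ψ x = 1 :=
      ⟨E.symm (Finsupp.single 0 1, 0), by simp [ψ]⟩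
    obtain ⟨t, ht⟩ := f.rangeRestrict_surjective x.toMul
    refine ⟨(AddMonoidHom.toMultiplicativeRight ψ).comp f.rangeRestrict, t, ?_⟩
    rw [MonoidHom.comp_apply, ht]
    change Multiplicative.ofAdd (ψ x) = _
    rw [hx]

lemma finite_commutatorSet_of_finite_quotient_center [Finite (G ⧸ Subgroup.center G)] :
    Finite (commutatorSet G) := by
  have : commutatorSet G ⊆ Set.range fun q : (G ⧸ Subgroup.center G) × (G ⧸ Subgroup.center G) =>
      ⁅q.1.out, q.2.out⁆ := by
    rintro _ ⟨x, y, rfl⟩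
    refine ⟨(x, y), ?_⟩
    obtain ⟨⟨a, ha⟩, hx⟩ := QuotientGroup.mk_out_eq_mul (Subgroup.center G) x
    obtain ⟨⟨c, hc⟩, hy⟩ := QuotientGroup.mk_out_eq_mul (Subgroup.center G) y
    rw [Subgroup.mem_center_iff] at ha hc
    simp only
    rw [hx, hy, commutatorElement_def, commutatorElement_def]
    simp only
    calc x * a * (y * c) * (x * a)⁻¹ * (y * c)⁻¹
        = x * (a * y) * c * a⁻¹ * x⁻¹ * c⁻¹ * y⁻¹ := by group
      _ = x * y * (a * c) * a⁻¹ * x⁻¹ * c⁻¹ * y⁻¹ := by rw [← ha]; group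
      _ = x * y * (c * x⁻¹) * c⁻¹ * y⁻¹ := by rw [hc]; group
      _ = x * y * x⁻¹ * y⁻¹ := by rw [← hc]; group
  exact (Set.finite_range _).subset this

lemma finite_of_finite_abelianization (G : Type u) [Group G] [Group.IsNilpotent G] :
    Group.FG G → Finite (Abelianization G) → Finite G := by
  refine Group.nilpotent_center_quotient_ind
    (P := fun G _ _ => Group.FG G → Finite (Abelianization G) → Finite G) G ?_ ?_
  · intros; infer_instance
  · intro G _ _ ih _ _
    have h1 : Function.Surjective (Abelianization.map (QuotientGroup.mk' (Subgroup.center G))) := by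
      intro x
      obtain ⟨y, rfl⟩ := QuotientGroup.mk_surjective x
      obtain ⟨z, rfl⟩ := QuotientGroup.mk_surjective y
      exact ⟨Abelianization.of z, rfl⟩
    have : Finite (G ⧸ Subgroup.center G) := ih inferInstance (Finite.of_surjective _ h1)
    have := finite_commutatorSet_of_finite_quotient_center (G := G)
    have h2 : Finite (commutator G) := inferInstance
    have h3 : Finite (G ⧸ commutator G) := ‹Finite (Abelianization G)›
    exact Finite.of_equiv _ (Subgroup.groupEquivQuotientProdSubgroup (s := commutator G)).symm

lemma exists_map_eq_ofAdd_one_of_isNilpotent [Infinite G] [Group.FG G] (h : Group.IsNilpotent G) :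
    ∃ φ : G →* Multiplicative ℤ, ∃ t, φ t = Multiplicative.ofAdd 1 := by
  refine exists_map_eq_ofAdd_one_of_infinite_range (Abelianization.of (G := G)) fun hfin => ?_
  have h1 : Set.range (Abelianization.of (G := G)) = Set.univ :=
    Set.range_eq_univ.2 QuotientGroup.mk_surjective
  rw [h1] at hfin
  have : Finite (Abelianization G) := Set.finite_univ_iff.1 hfin
  exact not_finite_iff_infinite.2 ‹_› (finite_of_finite_abelianization G inferInstance this)

open scoped RealInnerProductSpace

/-- An infinite finitely generated group of polynomial growth has a finite-index subgroup that maps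
onto the integers. -/
lemma HasPolynomialGrowth.exists_finiteIndex_map_eq_ofAdd_one [Infinite G] [Group.FG G]
    (h : HasPolynomialGrowth G d) : ∃ H : Subgroup G, H.FiniteIndex ∧
      ∃ φ : H →* Multiplicative ℤ, ∃ t, φ t = Multiplicative.ofAdd 1 := by
  classical
  obtain ⟨S, h1, hinv, hgen⟩ := exists_finset_inv_eq_closure_eq_top (G := G)
  obtain ⟨C, hC⟩ := h.exists_card_le S
  obtain ⟨K, _, _, _, π, b, hb, h0, hne⟩ := exists_harmonic_cocycle h1 hinv hgen hC
  obtain ⟨V, _, hV, s, hs, v, hv, hsv⟩ :=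
    exists_finiteDimensional_inner_cocycle_ne_zero π b hb hgen h0 hne hC
  let T : G → V →L[ℝ] V := fun g =>
    LinearMap.toContinuousLinearMap ((π g).toLinearMap.restrict (hV g))
  have hT : ∀ g (x : V), ((T g x : V) : K) = π g x := fun g x => rfl
  let ρ : G →* (V →L[ℝ] V) :=
    { toFun := T
      map_one' := by
        ext x
        rw [hT, isometricAction_one_apply]; rfl
      map_mul' := fun g k => by
        ext x
        rw [hT, isometricAction_mul_apply]; rfl }
  have hρ : ∀ g (x : V), ((ρ g x : V) : K) = π g x := fun g x => rfl
  have hρn : ∀ g, ∀ x : V, ‖ρ g x‖ = ‖x‖ := fun g x => (π g).norm_map x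
  have hρ1 : ∀ g, ‖ρ g‖ ≤ 1 := fun g =>
    ContinuousLinearMap.opNorm_le_bound _ zero_le_one fun x => by rw [hρn, one_mul]
  let β : G → V := fun g => V.orthogonalProjectionOnto (b g)
  have hβ : ∀ g (w : V), ⟪β g, w⟫ = ⟪b g, (w : K)⟫ := fun g w =>
    Submodule.inner_orthogonalProjectionOnto_eq_of_mem_right w (b g)
  have hβmul : ∀ x y, β (x * y) = β x + ρ x (β y) := by
    intro x y
    refine ext_inner_right ℝ fun w => ?_
    have h3 : (⟪ρ x (β y), w⟫ : ℝ) = ⟪b y, π x⁻¹ w⟫ := by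
      rw [← hβ y ⟨π x⁻¹ w, hV _ _ w.2⟩, Submodule.coe_inner, Submodule.coe_inner, hρ,
        inner_isometricAction]
    rw [inner_add_left, hβ, hβ, hb, inner_add_left, inner_isometricAction, h3]
  have hβ0 : ∑ s ∈ S, β s = 0 := by
    rw [← map_sum, h0, map_zero]
  have hβs : β s ≠ 0 := by
    intro h3
    refine hsv ?_
    have := hβ s ⟨v, hv⟩
    rw [h3, inner_zero_left] at this
    exact this.symm
  have hβ1 : β 1 = 0 := by simpa using hβmul 1 1
  let σ := ρ.toHomUnits
  have hσfg : Group.FG σ.range := Group.fg_of_surjective σ.rangeRestrict_surjective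
  rcases finite_or_infinite σ.range with hfin | hinf
  · have hNfin : σ.ker.FiniteIndex := Subgroup.finiteIndex_ker σ
    have hσker : ∀ x ∈ σ.ker, ρ x = 1 := fun x hx => by
      rw [MonoidHom.mem_ker] at hx
      rw [← MonoidHom.coe_toHomUnits ρ x, hx, Units.val_one]
    refine ⟨σ.ker, hNfin, ?_⟩
    let f : σ.ker →* Multiplicative V :=
      { toFun := fun x => Multiplicative.ofAdd (β x)
        map_one' := by rw [Subgroup.coe_one, hβ1]; rfl
        map_mul' := fun x y => by
          rw [Subgroup.coe_mul, hβmul, hσker x x.2]; rfl }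
    refine exists_map_eq_ofAdd_one_of_infinite_range f fun hrange => ?_
    have hβfin : (Set.range β).Finite := by
      have h3 : Set.range β ⊆ ⋃ q : Quotient (QuotientGroup.rightRel σ.ker),
          (fun x : Multiplicative V => x.toAdd + β q.out) '' Set.range f := by
        rintro _ ⟨g, rfl⟩
        rw [Set.mem_iUnion]
        set q : Quotient (QuotientGroup.rightRel σ.ker) := Quotient.mk _ g
        have h4 : g * q.out⁻¹ ∈ σ.ker := by
          rw [← QuotientGroup.rightRel_apply]
          exact Quotient.mk_out (s := QuotientGroup.rightRel σ.ker) g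
        refine ⟨q, f ⟨_, h4⟩, ⟨_, rfl⟩, ?_⟩
        change β (g * q.out⁻¹) + β q.out = β g
        have h5 := hβmul (g * q.out⁻¹) q.out
        rw [hσker _ h4, inv_mul_cancel_right] at h5
        rw [h5]; rfl
      have : Finite (Quotient (QuotientGroup.rightRel σ.ker)) :=
        Finite.of_equiv _ (QuotientGroup.quotientRightRelEquivQuotientLeftRel σ.ker).symm
      exact (Set.finite_iUnion fun q => hrange.image _).subset h3
    obtain ⟨_, ⟨g, rfl⟩, hmax⟩ := Set.exists_max_image _ (fun v : V => ‖v‖) hβfin ⟨_, ⟨1, rfl⟩⟩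
    have h6 : ∑ s ∈ S, ‖β (g * s) - β g‖ ^ 2 ≤ 0 := by
      have h7 : ∀ s ∈ S, ‖β (g * s) - β g‖ ^ 2 ≤ - 2 * ⟪ρ g (β s), β g⟫ := by
        intro s _
        have h8 := hmax _ ⟨g * s, rfl⟩
        have h9 : ‖β (g * s)‖ ^ 2 ≤ ‖β g‖ ^ 2 := by gcongr
        rw [norm_sub_sq_real]
        have h10 : (⟪β (g * s), β g⟫ : ℝ) = ‖β g‖ ^ 2 + ⟪ρ g (β s), β g⟫ := by
          rw [hβmul, inner_add_left, real_inner_self_eq_norm_sq]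
        linarith
      refine (Finset.sum_le_sum h7).trans ?_
      rw [← Finset.mul_sum, ← sum_inner, ← map_sum, hβ0, map_zero, inner_zero_left, mul_zero]
    have h11 := (Finset.sum_eq_zero_iff_of_nonneg fun _ _ => by positivity).1
      (le_antisymm h6 (Finset.sum_nonneg fun _ _ => by positivity)) s hs
    rw [hβmul, add_sub_cancel_left, hρn] at h11
    exact hβs (by simpa using h11)
  · have hgrowth := h.of_surjective _ σ.rangeRestrict_surjective
    let τ : σ.range →* (V →L[ℝ] V) := (Units.coeHom (V →L[ℝ] V)).comp σ.range.subtype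
    have hτ : ∀ x, ‖τ x‖ ≤ 1 := by
      rintro ⟨_, g, rfl⟩
      exact hρ1 g
    obtain ⟨L, hL, hLn⟩ := hgrowth.exists_isNilpotent_of_linear (A := V →L[ℝ] V) (ρ := τ)
      (Units.val_injective.comp σ.range.subtype_injective) hτ
    have hLinf : Infinite L := by
      rw [← not_finite_iff_infinite]
      intro hLfin
      have : Finite (σ.range ⧸ L) := Subgroup.finite_quotient_of_finiteIndex
      exact not_finite_iff_infinite.2 hinf
        (Finite.of_equiv _ (Subgroup.groupEquivQuotientProdSubgroup (s := L)).symm)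
    have : Group.FG L := inferInstance
    obtain ⟨φ, t, ht⟩ := exists_map_eq_ofAdd_one_of_isNilpotent hLn
    obtain ⟨t', ht'⟩ := σ.rangeRestrict.subgroupComap_surjective_of_surjective L
      σ.rangeRestrict_surjective t
    refine ⟨L.comap σ.rangeRestrict, ⟨?_⟩, φ.comp (σ.rangeRestrict.subgroupComap L), t', ?_⟩
    · rw [Subgroup.index_comap_of_surjective _ σ.rangeRestrict_surjective]
      exact hL.index_ne_zero
    · rw [MonoidHom.comp_apply, ht', ht]

end VirtualSurjection

section FiniteIndex

universe u v

variable {G : Type u} [Group G] {d : ℕ}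

lemma finite_monoidHom_of_fg [Group.FG G] (P : Type v) [Group P] [Finite P] : Finite (G →* P) := by
  obtain ⟨S, hS, hfin⟩ := Group.fg_iff.1 ‹Group.FG G›
  have : Finite S := hfin
  refine Finite.of_injective (fun f : G →* P => fun s : S => f s) fun f g hfg => ?_
  exact MonoidHom.eq_of_eqOn_dense hS fun s hs => congrFun hfg ⟨s, hs⟩

/-- A finite-index subgroup of a finitely generated group contains a characteristic finite-index
subgroup. -/
lemma exists_characteristic_le [Group.FG G] (H : Subgroup G) [H.FiniteIndex] :
    ∃ N : Subgroup G, N.Characteristic ∧ N.FiniteIndex ∧ N ≤ H := by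
  have : Finite (G ⧸ H) := Subgroup.finite_quotient_of_finiteIndex
  let P := Equiv.Perm (G ⧸ H)
  have := finite_monoidHom_of_fg (G := G) P
  refine ⟨⨅ f : G →* P, f.ker, ?_, ?_, ?_⟩
  · rw [Subgroup.characteristic_iff_le_comap]
    intro e
    rw [Subgroup.comap_iInf]
    refine le_iInf fun f => ?_
    rw [MonoidHom.comap_ker]
    exact iInf_le _ _
  · exact Subgroup.finiteIndex_iInf fun f => Subgroup.finiteIndex_ker f
  · refine (iInf_le _ (MulAction.toPermHom G (G ⧸ H))).trans fun g hg => ?_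
    have h1 : g • ((1 : G) : G ⧸ H) = ((1 : G) : G ⧸ H) :=
      Equiv.congr_fun (MonoidHom.mem_ker.1 hg) ((1 : G) : G ⧸ H)
    rw [← MulAction.mem_stabilizer_iff, MulAction.stabilizer_quotient] at h1
    exact h1

lemma fg_of_fg_map {G' : Type v} [Group G'] {f : G →* G'} (hf : Function.Injective f)
    {L : Subgroup G} (h : (L.map f).FG) : L.FG := by
  rw [← Group.fg_iff_subgroup_fg] at h ⊢
  exact Group.fg_of_surjective (f := (L.equivMapOfInjective f hf).symm.toMonoidHom)
    (L.equivMapOfInjective f hf).symm.surjective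

lemma fg_of_fg_inf (H : Subgroup G) [H.FiniteIndex] {L : Subgroup G} (h : (L ⊓ H).FG) : L.FG := by
  have : Finite (L ⧸ H.subgroupOf L) := Subgroup.finite_quotient_of_finiteIndex
  let r : L ⧸ H.subgroupOf L → G := fun q => (q.out : L)
  have hr : Subgroup.closure (Set.range r) ≤ L := by
    rw [Subgroup.closure_le]
    rintro _ ⟨q, rfl⟩
    exact (q.out : L).2
  have hfg : (Subgroup.closure (Set.range r)).FG :=
    (Group.fg_iff_subgroup_fg _).1 inferInstance
  have : L = Subgroup.closure (Set.range r) ⊔ L ⊓ H := by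
    refine le_antisymm (fun x hx => ?_) (sup_le hr inf_le_left)
    obtain ⟨⟨y, hy⟩, hxy⟩ := QuotientGroup.mk_out_eq_mul (H.subgroupOf L) ⟨x, hx⟩
    have h1 : r (⟨x, hx⟩ : L) = x * (y : G) := congrArg Subtype.val hxy
    have h2 : x = r (⟨x, hx⟩ : L) * ((y : G))⁻¹ := by rw [h1, mul_inv_cancel_right]
    rw [h2]
    exact mul_mem (Subgroup.mem_sup_left (Subgroup.subset_closure ⟨_, rfl⟩))
      (Subgroup.mem_sup_right (inv_mem ⟨y.2, hy⟩))
  rw [this]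
  exact hfg.sup h

lemma exists_isNilpotent_of_finiteIndex (H : Subgroup G) [hH : H.FiniteIndex]
    (h : ∃ L : Subgroup H, L.FiniteIndex ∧ Group.IsNilpotent L) :
    ∃ L : Subgroup G, L.FiniteIndex ∧ Group.IsNilpotent L := by
  obtain ⟨L, hL, hLn⟩ := h
  refine ⟨L.map H.subtype, ⟨?_⟩, Group.nilpotent_of_mulEquiv
    (L.equivMapOfInjective H.subtype H.subtype_injective)⟩
  rw [Subgroup.index_map_subtype]
  exact mul_ne_zero hL.index_ne_zero hH.index_ne_zero

/-- Finitely generated groups of polynomial growth are virtually nilpotent, and all of their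
subgroups are finitely generated. -/
theorem HasPolynomialGrowth.exists_isNilpotent_and_forall_fg (d : ℕ) :
    ∀ {G : Type u} [Group G] [Group.FG G] (_ : HasPolynomialGrowth G d),
      (∃ H : Subgroup G, H.FiniteIndex ∧ Group.IsNilpotent H) ∧ ∀ L : Subgroup G, L.FG := by
  induction d using Nat.strong_induction_on with
  | _ d ih =>
  intro G _ _ hG
  rcases finite_or_infinite G with hfin | hinf
  · exact ⟨⟨⊥, inferInstance, inferInstance⟩, fun L => (Group.fg_iff_subgroup_fg L).1 inferInstance⟩
  obtain ⟨G₁, hG₁, φ, t, ht⟩ := hG.exists_finiteIndex_map_eq_ofAdd_one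
  have h1 := hG.subgroup G₁
  obtain ⟨c, rfl, hc⟩ := h1.exists_ker φ ht
  have hKfg : Group.FG φ.ker := (Group.fg_iff_subgroup_fg _).2 (h1.fg_ker φ ht)
  obtain ⟨⟨K₀, hK₀, hK₀n⟩, hKall⟩ := ih c (Nat.lt_succ_self c) hc
  have hG₁all : ∀ L : Subgroup G₁, L.FG := fg_of_forall_fg_ker φ fun L hL => by
    rw [← Subgroup.map_subgroupOf_eq_of_le hL]
    exact fg_map _ (hKall _)
  refine ⟨?_, fun L => ?_⟩
  swap
  · refine fg_of_fg_inf G₁ ?_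
    rw [← Subgroup.subgroupOf_map_subtype]
    exact fg_map _ (hG₁all _)
  refine exists_isNilpotent_of_finiteIndex G₁ ?_
  obtain ⟨N', hN'c, hN'f, hN'K⟩ := exists_characteristic_le K₀
  set N : Subgroup G₁ := N'.map φ.ker.subtype with hN
  have hNn : N.Normal := inferInstance
  obtain ⟨n, hn⟩ := (Subgroup.isNilpotent_iff_lowerCentralSeries K₀).1 hK₀n
  have hNlcs : N.lowerCentralSeries n = ⊥ := by
    rw [hN, ← Subgroup.map_lowerCentralSeries, eq_bot_iff, ← Subgroup.map_bot φ.ker.subtype, ← hn]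
    exact Subgroup.map_mono (Subgroup.lowerCentralSeries_mono n hN'K)
  set G₂ := N ⊔ Subgroup.zpowers t with hG₂
  have hG₂f : G₂.FiniteIndex := by
    have : Finite (φ.ker ⧸ N') := Subgroup.finite_quotient_of_finiteIndex
    have : Finite (G₁ ⧸ G₂) := by
      refine Finite.of_surjective (fun q : φ.ker ⧸ N' => ((q.out : G₁) : G₁ ⧸ G₂)) fun q => ?_
      obtain ⟨g, rfl⟩ := QuotientGroup.mk_surjective q
      set k : ℤ := (φ g).toAdd with hk
      have hgk : g * t ^ (-k) ∈ φ.ker := by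
        rw [MonoidHom.mem_ker, map_mul, map_zpow, ht, ← ofAdd_zsmul]
        simp [hk]
      obtain ⟨⟨y, hy⟩, hxy⟩ := QuotientGroup.mk_out_eq_mul N' ⟨g * t ^ (-k), hgk⟩
      refine ⟨((⟨g * t ^ (-k), hgk⟩ : φ.ker) : φ.ker ⧸ N'), ?_⟩
      simp only
      rw [hxy, QuotientGroup.eq]
      have h2 : ((⟨g * t ^ (-k), hgk⟩ * y : φ.ker) : G₁)⁻¹ * g = (y : G₁)⁻¹ * t ^ k := by
        rw [Subgroup.coe_mul]
        group
      rw [h2]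
      exact mul_mem (Subgroup.mem_sup_left (inv_mem (Subgroup.mem_map_of_mem _ hy)))
        (Subgroup.mem_sup_right ⟨k, rfl⟩)
    exact Subgroup.finiteIndex_of_finite_quotient
  refine exists_isNilpotent_of_finiteIndex G₂ ?_
  have hNG₂ : N ≤ G₂ := le_sup_left
  have htG₂ : t ∈ G₂ := Subgroup.mem_sup_right (Subgroup.mem_zpowers t)
  refine (h1.subgroup G₂).exists_isNilpotent_of_nilpotent_by_cyclic n (N.subgroupOf G₂) ?_ ?_
    ⟨t, htG₂⟩ ?_
  · rw [← Subgroup.map_eq_bot_iff_of_injective _ G₂.subtype_injective,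
      Subgroup.map_lowerCentralSeries, Subgroup.map_subgroupOf_eq_of_le hNG₂, hNlcs]
  · exact fun L _ => fg_of_fg_map G₂.subtype_injective (hG₁all _)
  · rintro ⟨g, hg⟩
    obtain ⟨a, ha, b, ⟨r, rfl⟩, rfl⟩ := Subgroup.mem_sup_of_normal_left.1 hg
    refine ⟨-r, ?_⟩
    rw [Subgroup.mem_subgroupOf, Subgroup.coe_mul, Subgroup.coe_zpow]
    simpa using ha

end FiniteIndex

/-- **Gromov's polynomial growth theorem.** If `Γ` is generated by a finite symmetric
set `S` containing the identity and `|Sⁿ| ≤ C·n^D` for all `n ≥ 1`, then `Γ` is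
virtually nilpotent. -/
theorem gromov_polynomial_growth {Γ : Type*} [Group Γ] [DecidableEq Γ]
    (S : Finset Γ) (hsym : S⁻¹ = S) (hone : (1 : Γ) ∈ S)
    (hgen : Subgroup.closure (S : Set Γ) = ⊤)
    (C D : ℝ) (hC : 0 < C) (hD : 0 < D)
    (hgrowth : ∀ n : ℕ, 1 ≤ n → ((S ^ n).card : ℝ) ≤ C * (n : ℝ) ^ D) :
    IsVirtuallyNilpotent Γ := by
  have hcard : ∀ n, ((S : Set Γ) ^ n).ncard ≤ (⌈C⌉₊ + 1) * (n + 1) ^ ⌈D⌉₊ := by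
    intro n
    rw [← Finset.coe_pow, Set.ncard_coe_finset]
    rcases Nat.eq_zero_or_pos n with rfl | hn
    · simp
    have hn' : (1 : ℝ) ≤ n := by exact_mod_cast hn
    have h : ((S ^ n).card : ℝ) ≤ (⌈C⌉₊ + 1) * (n + 1) ^ ⌈D⌉₊ := by
      refine (hgrowth n hn).trans ?_
      have h1 : (n : ℝ) ^ D ≤ (n + 1) ^ ⌈D⌉₊ := by
        calc (n : ℝ) ^ D ≤ (n : ℝ) ^ (⌈D⌉₊ : ℝ) :=
              Real.rpow_le_rpow_of_exponent_le hn' (Nat.le_ceil D)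
          _ = (n : ℝ) ^ ⌈D⌉₊ := Real.rpow_natCast _ _
          _ ≤ (n + 1) ^ ⌈D⌉₊ := by gcongr; linarith
      have h2 : C ≤ ⌈C⌉₊ + 1 := (Nat.le_ceil C).trans (by linarith)
      exact mul_le_mul h2 h1 (by positivity) (by positivity)
    exact_mod_cast h
  have hFG : Group.FG Γ := Group.fg_iff.2 ⟨S, hgen, S.finite_toSet⟩
  have hinv : (S : Set Γ)⁻¹ = S := by rw [← Finset.coe_inv, hsym]
  exact ((HasPolynomialGrowth.of_closure_eq_top S.finite_toSet hinv (by exact_mod_cast hone) hgen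
    hcard).exists_isNilpotent_and_forall_fg).1
end

section
/- Let Γ be a group generated by a finite symmetric set S containing the identity, let H ≤ Γ be a subgroup, and let C > 0 and k be an integer with k ≥ C. If |S^k ∩ H| > |S^{2k}|/C, then the index of H in Γ is at most C. -/
open Pointwise

open Classical in
/-- The part of `T` in `H` translates into disjoint cosets through `S`, so that the number of
left cosets of `H` met by `S` times `|T ∩ H|` is at most `|S * T|`. -/
theorem card_image_mk_mul_card_filter_mem_le {G : Type*} [Group G] [DecidableEq G] (H : Subgroup G)
    (S T : Finset G) :
    (S.image (QuotientGroup.mk : G → G ⧸ H)).card * (T.filter (· ∈ H)).card ≤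
      (S * T).card := by
  have hrep : ∀ q ∈ S.image (QuotientGroup.mk : G → G ⧸ H), ∃ s ∈ S, (s : G ⧸ H) = q :=
    fun q hq => Finset.mem_image.1 hq
  choose! r hrS hr using hrep
  rw [← Finset.card_product]
  refine Finset.card_le_card_of_injOn (fun p => r p.1 * p.2) ?_ ?_
  · rintro ⟨q, t⟩ hp
    obtain ⟨hq, ht⟩ := Finset.mem_product.1 hp
    exact Finset.mul_mem_mul (hrS q hq) (Finset.mem_filter.1 ht).1
  · rintro ⟨q, t⟩ hp ⟨q', t'⟩ hp' heq
    obtain ⟨hq, ht⟩ := Finset.mem_product.1 hp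
    obtain ⟨hq', ht'⟩ := Finset.mem_product.1 hp'
    have hmk := congrArg (QuotientGroup.mk : G → G ⧸ H) heq
    simp only [QuotientGroup.mk_mul_of_mem _ (Finset.mem_filter.1 ht).2,
      QuotientGroup.mk_mul_of_mem _ (Finset.mem_filter.1 ht').2] at hmk
    obtain rfl : q = q' := by rw [← hr q hq, ← hr q' hq', hmk]
    exact Prod.ext rfl (mul_left_cancel heq)

/-- A nonempty set that is stable under a symmetric generating set of a transitive action is
everything. -/
theorem mem_of_forall_smul_mem {G X : Type*} [Group G] [MulAction G X]
    [MulAction.IsPretransitive G X] {S : Set G} (hsym : S⁻¹ = S)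
    (hgen : Subgroup.closure S = ⊤) {A : Set X} (hA : A.Nonempty)
    (hstable : ∀ s ∈ S, ∀ a ∈ A, s • a ∈ A) (x : X) : x ∈ A := by
  obtain ⟨a, ha⟩ := hA
  obtain ⟨g, rfl⟩ := MulAction.exists_smul_eq G a x
  have hg : g ∈ Subgroup.closure S := hgen ▸ Subgroup.mem_top g
  induction hg using Subgroup.closure_induction_left with
  | one => simpa using ha
  | mul_left s hs y _ ih => rw [mul_smul]; exact hstable s hs _ ih
  | inv_mul_cancel s hs y _ ih =>
    rw [mul_smul]
    exact hstable _ (by rwa [← hsym, Set.inv_mem_inv]) _ ih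

open Classical in
/-- The number of left cosets of `H` met by the powers of a symmetric generating set grows
strictly until all cosets are met. -/
theorem forall_mem_image_mk_pow_or_lt_card {G : Type*} [Group G] [DecidableEq G] (H : Subgroup G)
    {S : Finset G} (hsym : S⁻¹ = S) (hone : (1 : G) ∈ S)
    (hgen : Subgroup.closure (S : Set G) = ⊤) (n : ℕ) :
    (∀ q : G ⧸ H, q ∈ (S ^ n).image (QuotientGroup.mk : G → G ⧸ H)) ∨
      n < ((S ^ n).image (QuotientGroup.mk : G → G ⧸ H)).card := by
  induction n with
  | zero => right; simp
  | succ n ih =>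
    have hsub : (S ^ n).image (QuotientGroup.mk : G → G ⧸ H) ⊆
        (S ^ (n + 1)).image QuotientGroup.mk :=
      Finset.image_subset_image (Finset.pow_subset_pow_right hone n.le_succ)
    rcases ih with ih | ih
    · exact Or.inl fun q => hsub (ih q)
    rcases hsub.eq_or_ssubset with heq | hlt
    · left
      refine mem_of_forall_smul_mem (A := {q : G ⧸ H | q ∈ (S ^ (n + 1)).image
        QuotientGroup.mk}) (S := (S : Set G)) (by rw [← Finset.coe_inv, hsym]) hgen ?_ ?_
      · exact ⟨_, Finset.mem_image_of_mem _ (Finset.one_mem_pow hone)⟩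
      · intro s hs a ha
        rw [Set.mem_ofPred_eq, ← heq] at ha
        obtain ⟨g, hg, rfl⟩ := Finset.mem_image.1 ha
        refine Finset.mem_image.2 ⟨s * g, ?_, rfl⟩
        rw [pow_succ']
        exact Finset.mul_mem_mul hs hg
    · right
      have := Finset.card_lt_card hlt
      omega

/-- If `Γ` is generated by a finite symmetric set `S` containing the identity, `H ≤ Γ`
is a subgroup, `C > 0` and `k ≥ C` is an integer with `|S^k ∩ H| > |S^{2k}|/C`, then
`[Γ : H] ≤ C`. -/
theorem index_le_of_large_intersection {Γ : Type*} [Group Γ] [DecidableEq Γ]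
    (S : Finset Γ) (hsym : S⁻¹ = S) (hone : (1 : Γ) ∈ S)
    (hgen : Subgroup.closure (S : Set Γ) = ⊤)
    (H : Subgroup Γ) (C : ℝ) (hC : 0 < C) (k : ℕ) (hk : C ≤ (k : ℝ))
    (h : ((((S ^ k : Finset Γ) : Set Γ) ∩ (H : Set Γ)).ncard : ℝ) >
          ((S ^ (2 * k)).card : ℝ) / C) :
    H.index ≠ 0 ∧ (H.index : ℝ) ≤ C := by
  classical
  have hncard : (((S ^ k : Finset Γ) : Set Γ) ∩ (H : Set Γ)).ncard =
      ((S ^ k).filter (· ∈ H)).card := by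
    rw [← Set.ncard_coe_finset]
    congr 1
    ext x
    rw [Finset.coe_filter]
    rfl
  rw [hncard, gt_iff_lt, div_lt_iff₀ hC] at h
  have hmul := card_image_mk_mul_card_filter_mem_le H (S ^ k) (S ^ k)
  rw [← pow_add, ← two_mul] at hmul
  have hlt : (((S ^ k).image (QuotientGroup.mk : Γ → Γ ⧸ H)).card : ℝ) < C := by
    have hmul' : (((S ^ k).image (QuotientGroup.mk : Γ → Γ ⧸ H)).card : ℝ) *
        (((S ^ k).filter (· ∈ H)).card : ℝ) ≤ ((S ^ (2 * k)).card : ℝ) := by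
      exact_mod_cast hmul
    refine lt_of_mul_lt_mul_right ?_ (Nat.cast_nonneg ((S ^ k).filter (· ∈ H)).card)
    linarith
  have huniv := (forall_mem_image_mk_pow_or_lt_card H hsym hone hgen k).resolve_right fun hcard => by
    have : (k : ℝ) < ((S ^ k).image (QuotientGroup.mk : Γ → Γ ⧸ H)).card := by
      exact_mod_cast hcard
    linarith
  have hindex : H.index = ((S ^ k).image (QuotientGroup.mk : Γ → Γ ⧸ H)).card := by
    rw [Subgroup.index, ← Set.ncard_univ, ← Set.ncard_coe_finset]
    congr 1
    exact (Set.eq_univ_of_forall huniv).symm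
  refine ⟨?_, hindex ▸ hlt.le⟩
  rw [hindex]
  exact (Finset.card_pos.2 ⟨_, huniv ((1 : Γ) : Γ ⧸ H)⟩).ne'
end
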